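/- arXiv:1902.09019 — 6 statements merged into one kernel-verified Lean document; each statement's English description precedes it below -/
import Mathlib

section
/- For every ε > 0 there exists a constant C = C(ε) such that the following holds for every λ ≥ 1. Let a₁, a₂ ∈ ℝ with |a₁| ≤ 1 and |a₂| ≤ 1, set u₁ = (1,0,a₁) and u₂ = (0,1,a₂), and let Σ be the totally geodesic 2-dimensional submanifold of T³ parametrized by x(t₁,t₂) = x₀ + t₁ u₁ + t₂ u₂, (t₁,t₂) ∈ [−1,1]², with surface measure dσ = √(det[u_i·u_j]_{2×2}) dt₁dt₂. Then for every x₀ ∈ ℝ³ and every choice of complex coefficients (c_n)_{n∈E} with E = {n ∈ ℤ³ : |n| = λ}, ∫_{[−1,1]²} |Σ_{n∈E} c_n e^{i n·x(t)}|² dσ ≤ C · λ^{1/6+ε} · Σ_{n∈E} |c_n|². Equivalently, ‖e_λ‖_{L²(Σ)} ≲ λ^{1/12+ε} ‖e_λ‖_{L²(T³)} for every totally geodesic surface Σ ⊂ T³, with constant independent of Σ and λ. (Every totally geodesic surface in T³ is of this form after a permutation of the coordinates.) -/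
open MeasureTheory

/-- Dot product of a lattice point `n ∈ ℤ^d` with a real vector `x ∈ ℝ^d`. -/
noncomputable def dotIR {d : ℕ} (n : Fin d → ℤ) (x : Fin d → ℝ) : ℝ :=
  ∑ i, (n i : ℝ) * x i

lemma divisor_bound (ε : ℝ) (hε : 0 < ε) :
    ∃ C : ℝ, 0 < C ∧ ∀ n : ℕ, n ≠ 0 → (n.divisors.card : ℝ) ≤ C * (n : ℝ) ^ ε := by
  obtain ⟨P, hP⟩ := exists_nat_ge ((2 : ℝ) ^ (1 / ε))
  have hl2 : 0 < Real.log 2 := Real.log_pos (by norm_num)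
  set K : ℝ := 1 + 1 / (ε * Real.log 2) with hK
  have hK1 : 1 ≤ K := by
    have : 0 < 1 / (ε * Real.log 2) := by positivity
    linarith
  refine ⟨K ^ P, by positivity, fun n hn => ?_⟩
  rw [Nat.card_divisors hn]
  push_cast
  have hfac : (n : ℝ) ^ ε = ∏ p ∈ n.primeFactors, ((p : ℝ) ^ ε) ^ (n.factorization p) := by
    conv_lhs => rw [← Nat.prod_factorization_pow_eq_self hn]
    rw [Finsupp.prod, Nat.support_factorization]
    push_cast
    rw [← Real.finsetProd_rpow _ _ (fun i _ => by positivity)]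
    apply Finset.prod_congr rfl
    intro p _
    rw [← Real.rpow_natCast, ← Real.rpow_natCast, ← Real.rpow_mul (by positivity),
      ← Real.rpow_mul (by positivity), mul_comm]
  have key : ∀ p ∈ n.primeFactors, ((n.factorization p : ℝ) + 1) ≤
      (if p < P then K else 1) * ((p : ℝ) ^ ε) ^ (n.factorization p) := by
    intro p hp
    have hp2 : (2 : ℝ) ≤ p := by exact_mod_cast (Nat.prime_of_mem_primeFactors hp).two_le
    set k := n.factorization p
    split_ifs with h
    · have h1 : (2 : ℝ) ^ ε ≤ (p : ℝ) ^ ε := Real.rpow_le_rpow (by norm_num) hp2 hε.le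
      have h2 : 1 + (k : ℝ) * (ε * Real.log 2) ≤ ((2 : ℝ) ^ ε) ^ k := by
        rw [← Real.rpow_natCast, ← Real.rpow_mul (by norm_num), Real.rpow_def_of_pos (by norm_num)]
        have := Real.add_one_le_exp (Real.log 2 * (ε * k))
        nlinarith
      have h3 : ((2 : ℝ) ^ ε) ^ k ≤ ((p : ℝ) ^ ε) ^ k := by gcongr
      have h4 : (k : ℝ) + 1 ≤ K * (1 + (k : ℝ) * (ε * Real.log 2)) := by
        have : K * (1 + (k : ℝ) * (ε * Real.log 2))
          = 1 + (k : ℝ) * (ε * Real.log 2) + 1 / (ε * Real.log 2) + k := by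
            rw [hK]; field_simp; ring
        rw [this]
        have : 0 ≤ (k : ℝ) * (ε * Real.log 2) := by positivity
        have : 0 ≤ 1 / (ε * Real.log 2) := by positivity
        linarith
      calc _ ≤ _ := h4
        _ ≤ K * ((p : ℝ) ^ ε) ^ k := by gcongr; linarith
    · rw [one_mul]
      have h1 : (2 : ℝ) ≤ (p : ℝ) ^ ε := by
        have : (2 : ℝ) ^ (1 / ε) ≤ p := hP.trans (by exact_mod_cast not_lt.1 h)
        calc (2 : ℝ) = ((2 : ℝ) ^ (1 / ε)) ^ ε := by
              rw [← Real.rpow_mul (by norm_num)]; field_simp; simp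
          _ ≤ _ := Real.rpow_le_rpow (by positivity) this hε.le
      have h2 : (2 : ℝ) ^ k ≤ ((p : ℝ) ^ ε) ^ k := by gcongr
      have h3 : ((k + 1 : ℕ) : ℝ) ≤ (2 : ℝ) ^ k := by exact_mod_cast Nat.lt_two_pow_self
      push_cast at h3
      linarith
  calc _ ≤ ∏ p ∈ n.primeFactors, ((if p < P then K else 1) * ((p : ℝ) ^ ε) ^ (n.factorization p)) :=
        Finset.prod_le_prod (fun i _ => by positivity) key
    _ = (∏ p ∈ n.primeFactors, (if p < P then K else 1)) * (n : ℝ) ^ ε := by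
        rw [Finset.prod_mul_distrib, hfac]
    _ ≤ _ := by
        gcongr
        rw [Finset.prod_ite, Finset.prod_const, Finset.prod_const_one, mul_one]
        apply pow_le_pow_right₀ hK1
        calc _ ≤ (Finset.range P).card := by
              apply Finset.card_le_card
              intro x hx
              simp at hx ⊢
              exact hx.2
          _ = P := by simp

lemma quad_fiber (a b M : ℤ) (ha : 0 < a) (hb : 0 < b) (hM : 0 < M)
    (S : Finset (ℤ × ℤ)) (hS : ∀ x ∈ S, a * x.1 ^ 2 + b * x.2 ^ 2 = M)
    (hw : ∀ x ∈ S, ∀ y ∈ S, M ∣ 2 * (x.1 * y.2 - y.1 * x.2)) : S.card ≤ 10 := by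
  rcases S.eq_empty_or_nonempty with rfl | ⟨⟨X, Y⟩, h1⟩
  · simp
  have hXY := hS _ h1
  simp only at hXY
  have hk : ∀ y ∈ S, ∃ k : ℤ, 2 * (X * y.2 - y.1 * Y) = M * k := fun y hy => hw _ h1 _ hy
  choose! k hk using hk
  have hid : ∀ y ∈ S, (a * X * y.1 + b * Y * y.2) ^ 2 + a * b * (X * y.2 - y.1 * Y) ^ 2 = M ^ 2 := by
    intro y hy
    have h2 := hS _ hy
    rw [sq M]
    nth_rewrite 1 [← hXY]
    rw [← h2]; ring
  have hcard : (Finset.Icc (-2 : ℤ) 2 ×ˢ (Finset.univ : Finset Bool)).card = 10 := by decide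
  rw [← hcard]
  apply Finset.card_le_card_of_injOn (fun y => (k y, decide (0 ≤ a * X * y.1 + b * Y * y.2)))
  · intro y hy
    have hy : y ∈ S := hy
    simp only [Finset.coe_product, Set.mem_prod, Finset.coe_Icc, Set.mem_Icc, Finset.coe_univ,
      Set.mem_univ, and_true]
    have h3 := hid y hy
    have h4 := hk y hy
    set w := X * y.2 - y.1 * Y
    have hab : 1 ≤ a * b := by nlinarith
    have h5 : w ^ 2 ≤ M ^ 2 := by nlinarith [sq_nonneg (a * X * y.1 + b * Y * y.2), sq_nonneg w]
    have h6 := abs_le_of_sq_le_sq' h5 hM.le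
    constructor
    · nlinarith
    · nlinarith
  · intro y hy z hz hyz
    have hy : y ∈ S := hy
    have hz : z ∈ S := hz
    simp only [Prod.mk.injEq, decide_eq_decide] at hyz
    obtain ⟨e1, e2⟩ := hyz
    have hw1 : X * y.2 - y.1 * Y = X * z.2 - z.1 * Y := by
      have := hk y hy; have := hk z hz; rw [e1] at *; linarith
    have ht : (a * X * y.1 + b * Y * y.2) = (a * X * z.1 + b * Y * z.2) := by
      have h3 := hid y hy
      have h4 := hid z hz
      rw [hw1] at h3
      have h5 : (a * X * y.1 + b * Y * y.2) ^ 2 = (a * X * z.1 + b * Y * z.2) ^ 2 := by linarith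
      rcases sq_eq_sq_iff_eq_or_eq_neg.1 h5 with h | h
      · exact h
      · rw [h] at e2 ⊢
        by_cases h0 : 0 ≤ a * X * z.1 + b * Y * z.2
        · have := e2.2 h0; linarith
        · exact absurd (e2.1 (by linarith)) h0
    have hA : M * y.1 = M * z.1 := by
      rw [← hXY]; linear_combination X * ht - b * Y * hw1
    have hB : M * y.2 = M * z.2 := by
      rw [← hXY]; linear_combination Y * ht + a * X * hw1
    exact Prod.ext (mul_left_cancel₀ hM.ne' hA) (mul_left_cancel₀ hM.ne' hB)

lemma quad_prim (a b : ℤ) (M : ℕ) (ha : 0 < a) (hb : 0 < b) (hM : 0 < M)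
    (hMa : IsCoprime (M : ℤ) a) (hMb : IsCoprime (M : ℤ) b)
    (S : Finset (ℤ × ℤ)) (hS : ∀ x ∈ S, a * x.1 ^ 2 + b * x.2 ^ 2 = M)
    (hp : ∀ x ∈ S, IsCoprime x.1 x.2) : S.card ≤ 10 * M.divisors.card := by
  rcases S.eq_empty_or_nonempty with rfl | ⟨⟨X, Y⟩, h1⟩
  · simp
  have hXY := hS _ h1
  have hc := hp _ h1
  simp only at hXY hc
  have hMZ : (0 : ℤ) < M := by exact_mod_cast hM
  have hMY : IsCoprime (M : ℤ) Y := by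
    have h2 : IsCoprime (a * X ^ 2) Y := by
      refine IsCoprime.mul_left ?_ hc.pow_left
      by_contra hcon
      rw [Int.isCoprime_iff_gcd_eq_one] at hcon
      obtain ⟨p, hp, hpd⟩ := Nat.exists_prime_and_dvd hcon
      have hpa : (p : ℤ) ∣ a := (Int.natCast_dvd_natCast.2 hpd).trans (Int.gcd_dvd_left ..)
      have hpY : (p : ℤ) ∣ Y := (Int.natCast_dvd_natCast.2 hpd).trans (Int.gcd_dvd_right ..)
      have hpM : (p : ℤ) ∣ M := by
        rw [← hXY]
        exact dvd_add (hpa.mul_right _) ((hpY.pow (by norm_num)).mul_left _)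
      have := hMa.isUnit_of_dvd' hpM hpa
      exact (Nat.prime_iff_prime_int.1 hp).not_isUnit this
    rw [← hXY]
    have e : a * X ^ 2 + b * Y ^ 2 = a * X ^ 2 + b * Y * Y := by ring
    rw [e]
    exact h2.add_mul_right_left (b * Y)
  have hMX : IsCoprime (M : ℤ) X := by
    have h2 : IsCoprime (b * Y ^ 2) X := by
      refine IsCoprime.mul_left ?_ hc.symm.pow_left
      by_contra hcon
      rw [Int.isCoprime_iff_gcd_eq_one] at hcon
      obtain ⟨p, hp, hpd⟩ := Nat.exists_prime_and_dvd hcon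
      have hpa : (p : ℤ) ∣ b := (Int.natCast_dvd_natCast.2 hpd).trans (Int.gcd_dvd_left ..)
      have hpY : (p : ℤ) ∣ X := (Int.natCast_dvd_natCast.2 hpd).trans (Int.gcd_dvd_right ..)
      have hpM : (p : ℤ) ∣ M := by
        rw [← hXY]
        exact dvd_add ((hpY.pow (by norm_num)).mul_left _) (hpa.mul_right _)
      have := hMb.isUnit_of_dvd' hpM hpa
      exact (Nat.prime_iff_prime_int.1 hp).not_isUnit this
    rw [← hXY]
    have e : a * X ^ 2 + b * Y ^ 2 = b * Y ^ 2 + a * X * X := by ring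
    rw [e]
    exact h2.add_mul_right_left (a * X)
  have huv : ∀ y ∈ S, (M : ℤ) ∣ (X * y.2 - y.1 * Y) * (X * y.2 + y.1 * Y) := by
    intro y hy
    apply hMa.dvd_of_dvd_mul_left
    refine ⟨y.2 ^ 2 - Y ^ 2, ?_⟩
    have h2 := hS y hy
    linear_combination y.2 ^ 2 * hXY - Y ^ 2 * h2
  apply Finset.card_le_mul_card_image_of_maps_to (f := fun y : ℤ × ℤ =>
    Int.gcd M (X * y.2 - y.1 * Y)) (t := M.divisors)
  · intro y hy
    rw [Nat.mem_divisors]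
    refine ⟨?_, hM.ne'⟩
    exact_mod_cast Int.gcd_dvd_left (M : ℤ) (X * y.2 - y.1 * Y)
  · intro g hg
    apply quad_fiber a b M ha hb hMZ
    · intro x hx
      exact hS _ (Finset.mem_filter.1 hx).1
    · intro x hx y hy
      rw [Finset.mem_filter] at hx hy
      have hgM : (g : ℤ) ∣ M := by
        exact_mod_cast (Nat.mem_divisors.1 hg).1
      obtain ⟨h, hh⟩ := hgM
      have hg0 : (g : ℤ) ≠ 0 := by
        rintro h0; rw [h0] at hh; simp at hh; omega
      have hu : ∀ z ∈ S, Int.gcd M (X * z.2 - z.1 * Y) = g →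
          (g : ℤ) ∣ (X * z.2 - z.1 * Y) ∧ h ∣ (X * z.2 + z.1 * Y) := by
        intro z hz hzg
        have hgu : (g : ℤ) ∣ (X * z.2 - z.1 * Y) := by
          rw [← hzg]; exact Int.gcd_dvd_right ..
        refine ⟨hgu, ?_⟩
        obtain ⟨u, hu⟩ := hgu
        have hcop : IsCoprime h u := by
          rw [Int.isCoprime_iff_gcd_eq_one]
          have h3 : g * Int.gcd h u = g := by
            conv_rhs => rw [← hzg, hh, hu, Int.gcd_mul_left]
            simp
          have hg0' : g ≠ 0 := by exact_mod_cast hg0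
          exact Nat.eq_of_mul_eq_mul_left (Nat.pos_of_ne_zero hg0') (by simpa using h3)
        have h4 := huv z hz
        rw [hu, hh, mul_assoc] at h4
        exact hcop.dvd_of_dvd_mul_left ((mul_dvd_mul_iff_left hg0).1 h4)
      obtain ⟨⟨u1, hu1⟩, ⟨v1, hv1⟩⟩ := hu x hx.1 hx.2
      obtain ⟨⟨u2, hu2⟩, ⟨v2, hv2⟩⟩ := hu y hy.1 hy.2
      have hd : (M : ℤ) ∣ X * (Y * (2 * (x.1 * y.2 - y.1 * x.2))) := by
        refine ⟨v1 * u2 - u1 * v2, ?_⟩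
        have : X * (Y * (2 * (x.1 * y.2 - y.1 * x.2))) =
          (X * x.2 + x.1 * Y) * (X * y.2 - y.1 * Y) - (X * x.2 - x.1 * Y) * (X * y.2 + y.1 * Y) := by
          ring
        rw [this, hu1, hv1, hu2, hv2, hh]; ring
      exact hMY.dvd_of_dvd_mul_left (hMX.dvd_of_dvd_mul_left hd)

lemma quad_swap {S : Finset (ℤ × ℤ)} : (S.image Prod.swap).card = S.card :=
  Finset.card_image_of_injective _ Prod.swap_injective

lemma divisors_mono {m n : ℕ} (hn : n ≠ 0) (h : m ∣ n) : m.divisors.card ≤ n.divisors.card :=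
  Finset.card_le_card (Nat.divisors_subset_of_dvd hn h)

lemma quad_count (M : ℕ) : 0 < M → ∀ a b : ℤ, 0 < a → 0 < b → 
    ∀ S : Finset (ℤ × ℤ), (∀ x ∈ S, a * x.1 ^ 2 + b * x.2 ^ 2 = M) → 
      S.card ≤ 10 * M.divisors.card ^ 2 := by
  induction M using Nat.strong_induction_on with
  | _ M ih =>
  intro hM
  have red : ∀ p : ℕ, p.Prime → (p : ℤ) ∣ M → ∀ a b : ℤ, 0 < a → 0 < b → (p : ℤ) ∣ a →
    ∀ S : Finset (ℤ × ℤ), (∀ x ∈ S, a * x.1 ^ 2 + b * x.2 ^ 2 = M) → 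
      S.card ≤ 10 * M.divisors.card ^ 2 := by
    intro p hp hpM a b ha hb hpa S hS
    have hpM' : p ∣ M := by exact_mod_cast hpM
    obtain ⟨M', rfl⟩ := hpM'
    obtain ⟨a', rfl⟩ := hpa
    have hp0 : (0 : ℤ) < p := by exact_mod_cast hp.pos
    have hM' : 0 < M' := Nat.pos_of_mul_pos_left hM
    have ha' : 0 < a' := pos_of_mul_pos_right ha hp0.le
    have hlt : M' < p * M' := by nlinarith [hp.two_le]
    have hmono : 10 * M'.divisors.card ^ 2 ≤ 10 * (p * M').divisors.card ^ 2 := by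
      have := divisors_mono hM.ne' (Dvd.intro_left p rfl : M' ∣ p * M')
      gcongr
    refine le_trans ?_ hmono
    have ih := ih M' hlt hM'
    have hpp : Prime (p : ℤ) := Nat.prime_iff_prime_int.1 hp
    by_cases hpb : (p : ℤ) ∣ b
    · obtain ⟨b', rfl⟩ := hpb
      have hb' : 0 < b' := pos_of_mul_pos_right hb hp0.le
      apply ih a' b' ha' hb' S
      intro x hx
      have := hS x hx
      push_cast at this
      apply mul_left_cancel₀ hp0.ne'
      linarith
    · have hdiv : ∀ x ∈ S, ∃ y, x.2 = p * y := by
        intro x hx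
        have := hS x hx
        push_cast at this
        have h2 : (p : ℤ) ∣ b * x.2 ^ 2 := ⟨M' - a' * x.1 ^ 2, by linarith⟩
        exact hpp.dvd_of_dvd_pow ((hpp.dvd_or_dvd h2).resolve_left hpb)
      choose! f hf using hdiv
      have hinj : Set.InjOn (fun x : ℤ × ℤ => (x.1, f x)) S := by
        intro x hx y hy hxy
        simp only [Prod.mk.injEq] at hxy
        refine Prod.ext hxy.1 ?_
        rw [hf x hx, hf y hy, hxy.2]
      rw [← Finset.card_image_of_injOn hinj]
      apply ih a' (b * p) ha' (by positivity)
      intro z hz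
      obtain ⟨x, hx, rfl⟩ := Finset.mem_image.1 hz
      have := hS x hx
      push_cast at this
      rw [hf x hx] at this
      apply mul_left_cancel₀ hp0.ne'
      simp only
      linarith
  intro a b ha hb S hS
  by_cases hMa : IsCoprime (M : ℤ) a
  swap
  · rw [Int.isCoprime_iff_gcd_eq_one] at hMa
    obtain ⟨p, hp, hpd⟩ := Nat.exists_prime_and_dvd hMa
    exact red p hp ((Int.natCast_dvd_natCast.2 hpd).trans (Int.gcd_dvd_left ..)) a b ha hb
      ((Int.natCast_dvd_natCast.2 hpd).trans (Int.gcd_dvd_right ..)) S hS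
  by_cases hMb : IsCoprime (M : ℤ) b
  swap
  · rw [Int.isCoprime_iff_gcd_eq_one] at hMb
    obtain ⟨p, hp, hpd⟩ := Nat.exists_prime_and_dvd hMb
    rw [← quad_swap]
    apply red p hp ((Int.natCast_dvd_natCast.2 hpd).trans (Int.gcd_dvd_left ..)) b a hb ha
      ((Int.natCast_dvd_natCast.2 hpd).trans (Int.gcd_dvd_right ..))
    intro z hz
    obtain ⟨x, hx, rfl⟩ := Finset.mem_image.1 hz
    have := hS x hx
    simp only [Prod.fst_swap, Prod.snd_swap]
    linarith
  rw [sq, ← mul_assoc]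
  have hg2 : ∀ x ∈ S, (Int.gcd x.1 x.2) ^ 2 ∣ M := by
    intro x hx
    have h := hS x hx
    have h1 : ((Int.gcd x.1 x.2 : ℕ) : ℤ) ^ 2 ∣ M := by
      rw [← h]
      exact dvd_add ((pow_dvd_pow_of_dvd (Int.gcd_dvd_left ..) 2).mul_left _)
        ((pow_dvd_pow_of_dvd (Int.gcd_dvd_right ..) 2).mul_left _)
    exact_mod_cast h1
  apply Finset.card_le_mul_card_image_of_maps_to (f := fun y : ℤ × ℤ => Int.gcd y.1 y.2)
    (t := M.divisors)
  · intro x hx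
    rw [Nat.mem_divisors]
    exact ⟨(dvd_pow_self _ (by norm_num)).trans (hg2 x hx), hM.ne'⟩
  · intro g hg
    by_cases hgM : g ^ 2 ∣ M
    swap
    · rw [Finset.card_eq_zero.2]
      · simp
      · rw [Finset.filter_eq_empty_iff]
        intro x hx h
        exact hgM (h ▸ hg2 x hx)
    obtain ⟨M', hM'⟩ := hgM
    have hg0 : 0 < g := Nat.pos_of_mem_divisors hg
    have hgZ : (0 : ℤ) < g := by exact_mod_cast hg0
    have hM'0 : 0 < M' := by
      rcases Nat.eq_zero_or_pos M' with h | h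
      · rw [h] at hM'; omega
      · exact h
    have hdM : M' ∣ M := ⟨g ^ 2, by rw [hM']; ring⟩
    have hdMZ : (M' : ℤ) ∣ M := by exact_mod_cast hdM
    refine le_trans ?_ (Nat.mul_le_mul_left 10 (divisors_mono hM.ne' hdM))
    set T := S.filter (fun y : ℤ × ℤ => Int.gcd y.1 y.2 = g) with hT
    have hTd : ∀ x ∈ T, ∃ y : ℤ × ℤ, x.1 = g * y.1 ∧ x.2 = g * y.2 ∧ IsCoprime y.1 y.2 := by
      intro x hx
      obtain ⟨hx1, hx2⟩ := Finset.mem_filter.1 hx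
      obtain ⟨u, hu⟩ : (g : ℤ) ∣ x.1 := by rw [← hx2]; exact Int.gcd_dvd_left ..
      obtain ⟨v, hv⟩ : (g : ℤ) ∣ x.2 := by rw [← hx2]; exact Int.gcd_dvd_right ..
      refine ⟨(u, v), hu, hv, ?_⟩
      rw [Int.isCoprime_iff_gcd_eq_one]
      have h3 : g * Int.gcd u v = g := by
        conv_rhs => rw [← hx2, hu, hv, Int.gcd_mul_left]
        simp
      exact Nat.eq_of_mul_eq_mul_left hg0 (by simpa using h3)
    choose! f hf1 hf2 hf3 using hTd
    have hinj : Set.InjOn f T := by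
      intro x hx y hy hxy
      refine Prod.ext ?_ ?_
      · rw [hf1 x hx, hf1 y hy, hxy]
      · rw [hf2 x hx, hf2 y hy, hxy]
    rw [← Finset.card_image_of_injOn hinj]
    apply quad_prim a b M' ha hb hM'0 (hMa.of_isCoprime_of_dvd_left hdMZ)
      (hMb.of_isCoprime_of_dvd_left hdMZ)
    · intro z hz
      obtain ⟨x, hx, rfl⟩ := Finset.mem_image.1 hz
      have := hS x (Finset.mem_filter.1 hx).1
      rw [hf1 x hx, hf2 x hx, hM'] at this
      push_cast at this
      apply mul_left_cancel₀ (pow_pos hgZ 2).ne'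
      linarith
    · intro z hz
      obtain ⟨x, hx, rfl⟩ := Finset.mem_image.1 hz
      exact hf3 x hx

lemma circle0 {α : Type*} (S : Finset α) (y1 y2 y3 : α → ℤ)
    (hinj : ∀ x ∈ S, ∀ z ∈ S, y1 x = y1 z → y2 x = y2 z → y3 x = y3 z → x = z)
    (m1 m2 m3 p1 p2 p3 : ℤ) (hp3 : p3 ≠ 0)
    (hpl : ∀ x ∈ S, p1 * y1 x + p2 * y2 x + p3 * y3 x = 0)
    (hsp : ∀ x ∈ S, y1 x ^ 2 + y2 x ^ 2 + y3 x ^ 2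
      + 2 * (m1 * y1 x + m2 * y2 x + m3 * y3 x) = 0)
    (lam : ℝ) (hlam : 1 ≤ lam)
    (hp1b : |(p1 : ℝ)| ≤ 8 * lam ^ 2) (hp2b : |(p2 : ℝ)| ≤ 8 * lam ^ 2)
    (hp3b : |(p3 : ℝ)| ≤ 8 * lam ^ 2)
    (hm1b : |(m1 : ℝ)| ≤ lam) (hm2b : |(m2 : ℝ)| ≤ lam) (hm3b : |(m3 : ℝ)| ≤ lam) :
    ∃ M : ℕ, (M : ℝ) ≤ 10 ^ 9 * lam ^ 18 ∧ S.card ≤ 10 * M.divisors.card ^ 2 + 1 := by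
  have hl0 : 0 ≤ lam := by linarith
  obtain ⟨A, hA⟩ : ∃ A, A = p3 ^ 2 + p1 ^ 2 := ⟨_, rfl⟩
  obtain ⟨B, hB⟩ : ∃ B, B = p1 * p2 := ⟨_, rfl⟩
  obtain ⟨D, hD⟩ : ∃ D, D = p3 ^ 2 * m1 - p3 * m3 * p1 := ⟨_, rfl⟩
  obtain ⟨G, hG⟩ : ∃ G, G = p3 ^ 2 * m2 - p3 * m3 * p2 := ⟨_, rfl⟩
  obtain ⟨Δ, hΔ⟩ : ∃ Δ, Δ = p3 ^ 2 * (p3 ^ 2 + p1 ^ 2 + p2 ^ 2) := ⟨_, rfl⟩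
  have hp3sq : 0 < p3 ^ 2 := by positivity
  have hA0 : 0 < A := by rw [hA]; positivity
  have hΔ0 : 0 < Δ := by rw [hΔ]; positivity
  obtain ⟨M, hM⟩ : ∃ M : ℕ, (M : ℤ) = Δ * D ^ 2 + (A * G - B * D) ^ 2 := by
    refine ⟨(Δ * D ^ 2 + (A * G - B * D) ^ 2).toNat, ?_⟩
    rw [Int.toNat_of_nonneg (by positivity)]
  have heq : ∀ x ∈ S, Δ * (A * y1 x + B * y2 x + D) ^ 2 + 1 * (Δ * y2 x + (A * G - B * D)) ^ 2 = M := by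
    intro x hx
    have h1 := hpl x hx
    have h2 := hsp x hx
    have h3 : p3 * y3 x = -(p1 * y1 x + p2 * y2 x) := by linarith
    have h4 : p3 ^ 2 * (y1 x ^ 2 + y2 x ^ 2) + (p1 * y1 x + p2 * y2 x) ^ 2
      + 2 * p3 ^ 2 * (m1 * y1 x + m2 * y2 x) - 2 * p3 * m3 * (p1 * y1 x + p2 * y2 x) = 0 := by
      have h5 : (p1 * y1 x + p2 * y2 x) ^ 2 = (p3 * y3 x) ^ 2 := by rw [h3]; ring
      rw [h5]
      linear_combination p3 ^ 2 * h2 - 2 * p3 * m3 * h3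
    rw [hM, hΔ, hG, hD, hB, hA]
    linear_combination (p3 ^ 2 * (p3 ^ 2 + p1 ^ 2 + p2 ^ 2)) * (p3 ^ 2 + p1 ^ 2) * h4
  refine ⟨M, ?_, ?_⟩
  · have hMR : (M : ℝ) = Δ * D ^ 2 + (A * G - B * D) ^ 2 := by exact_mod_cast hM
    have q1 : |(p1 : ℝ)| ^ 2 ≤ (8 * lam ^ 2) ^ 2 := by gcongr
    have q2 : |(p2 : ℝ)| ^ 2 ≤ (8 * lam ^ 2) ^ 2 := by gcongr
    have q3 : |(p3 : ℝ)| ^ 2 ≤ (8 * lam ^ 2) ^ 2 := by gcongr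
    rw [sq_abs] at q1 q2 q3
    have bA : |(A : ℝ)| ≤ 128 * lam ^ 4 := by
      rw [hA]; push_cast; rw [abs_of_nonneg (by positivity)]; nlinarith
    have bB : |(B : ℝ)| ≤ 64 * lam ^ 4 := by
      rw [hB]; push_cast; rw [abs_mul]
      calc _ ≤ (8 * lam ^ 2) * (8 * lam ^ 2) := by gcongr
        _ = _ := by ring
    have bD : |(D : ℝ)| ≤ 128 * lam ^ 5 := by
      rw [hD]; push_cast
      refine (abs_sub _ _).trans ?_
      rw [abs_mul, abs_mul, abs_mul, abs_pow]
      calc _ ≤ (8 * lam ^ 2) ^ 2 * lam + (8 * lam ^ 2) * lam * (8 * lam ^ 2) := by gcongr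
        _ = _ := by ring
    have bG : |(G : ℝ)| ≤ 128 * lam ^ 5 := by
      rw [hG]; push_cast
      refine (abs_sub _ _).trans ?_
      rw [abs_mul, abs_mul, abs_mul, abs_pow]
      calc _ ≤ (8 * lam ^ 2) ^ 2 * lam + (8 * lam ^ 2) * lam * (8 * lam ^ 2) := by gcongr
        _ = _ := by ring
    have bΔ : (Δ : ℝ) ≤ 12288 * lam ^ 8 := by
      rw [hΔ]; push_cast
      calc _ ≤ (8 * lam ^ 2) ^ 2 * ((8 * lam ^ 2) ^ 2 + (8 * lam ^ 2) ^ 2 + (8 * lam ^ 2) ^ 2) := by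
            gcongr
        _ = _ := by ring
    have bH : |(A * G - B * D : ℝ)| ≤ 24576 * lam ^ 9 := by
      refine (abs_sub _ _).trans ?_
      rw [abs_mul, abs_mul]
      calc _ ≤ 128 * lam ^ 4 * (128 * lam ^ 5) + 64 * lam ^ 4 * (128 * lam ^ 5) := by gcongr
        _ = _ := by ring
    rw [hMR, ← sq_abs (D : ℝ), ← sq_abs (A * G - B * D : ℝ)]
    calc _ ≤ 12288 * lam ^ 8 * (128 * lam ^ 5) ^ 2 + (24576 * lam ^ 9) ^ 2 := by gcongr
      _ = (12288 * 128 ^ 2 + 24576 ^ 2) * lam ^ 18 := by ring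
      _ ≤ _ := by gcongr; norm_num
  · set f : α → ℤ × ℤ := fun x => (A * y1 x + B * y2 x + D, Δ * y2 x + (A * G - B * D)) with hf
    have hfinj : Set.InjOn f S := by
      intro x hx z hz hxz
      simp only [hf, Prod.mk.injEq] at hxz
      obtain ⟨e1, e2⟩ := hxz
      have e2' : y2 x = y2 z := mul_left_cancel₀ hΔ0.ne' (by linarith)
      have e1' : y1 x = y1 z := mul_left_cancel₀ hA0.ne' (by rw [e2'] at e1; linarith)
      have e3' : y3 x = y3 z := by
        apply mul_left_cancel₀ hp3
        have h1 := hpl x hx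
        have h2 := hpl z hz
        rw [e1', e2'] at h1
        linarith
      exact hinj x hx z hz e1' e2' e3'
    have hT : ∀ z ∈ S.image f, Δ * z.1 ^ 2 + 1 * z.2 ^ 2 = M := by
      intro z hz
      obtain ⟨x, hx, rfl⟩ := Finset.mem_image.1 hz
      exact heq x hx
    rw [← Finset.card_image_of_injOn hfinj]
    rcases Nat.eq_zero_or_pos M with h0 | h0
    · have : (S.image f).card ≤ 1 := by
        rw [Finset.card_le_one]
        have hz : ∀ z ∈ S.image f, z = (0, 0) := by
          intro z hz
          have h := hT z hz
          rw [h0, Nat.cast_zero] at h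
          have h1 : z.1 ^ 2 = 0 := by nlinarith [sq_nonneg z.1, sq_nonneg z.2]
          have h2 : z.2 ^ 2 = 0 := by nlinarith [sq_nonneg z.1, sq_nonneg z.2]
          exact Prod.ext (by simpa using h1) (by simpa using h2)
        intro x hx y hy
        rw [hz x hx, hz y hy]
      omega
    · have := quad_count M h0 Δ 1 hΔ0 one_pos _ hT
      omega

lemma circle_count (ε : ℝ) (hε : 0 < ε) : ∃ C : ℝ, 2 ≤ C ∧
    ∀ (S : Finset (Fin 3 → ℤ)) (m p : Fin 3 → ℤ) (lam : ℝ), 1 ≤ lam → p ≠ 0 →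
    (∀ x ∈ S, p 0 * (x 0 - m 0) + p 1 * (x 1 - m 1) + p 2 * (x 2 - m 2) = 0) →
    (∀ x ∈ S, (x 0 - m 0) ^ 2 + (x 1 - m 1) ^ 2 + (x 2 - m 2) ^ 2
      + 2 * (m 0 * (x 0 - m 0) + m 1 * (x 1 - m 1) + m 2 * (x 2 - m 2)) = 0) →
    (∀ i, |(p i : ℝ)| ≤ 8 * lam ^ 2) → (∀ i, |(m i : ℝ)| ≤ lam) →
    (S.card : ℝ) ≤ C * lam ^ ε := by
  obtain ⟨C, hC, hd⟩ := divisor_bound (ε / 36) (by positivity)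
  refine ⟨10 * (C * ((10 : ℝ) ^ 9) ^ (ε / 36)) ^ 2 + 2, ?_, ?_⟩
  · have : 0 ≤ (C * ((10 : ℝ) ^ 9) ^ (ε / 36)) ^ 2 := by positivity
    linarith
  intro S m p lam hlam hp hpl hsp hpb hmb
  have hl0 : 0 < lam := by linarith
  have hM : ∃ M : ℕ, (M : ℝ) ≤ 10 ^ 9 * lam ^ 18 ∧ S.card ≤ 10 * M.divisors.card ^ 2 + 1 := by
    by_cases h2 : p 2 = 0
    · by_cases h1 : p 1 = 0
      · by_cases h0 : p 0 = 0
        · exfalso; apply hp; ext i; fin_cases i <;> simp [h0, h1, h2]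
        · apply circle0 S (fun x => x 1 - m 1) (fun x => x 2 - m 2) (fun x => x 0 - m 0) ?_
            (m 1) (m 2) (m 0) (p 1) (p 2) (p 0) h0 ?_ ?_ lam hlam (hpb _) (hpb _) (hpb _)
            (hmb _) (hmb _) (hmb _)
          · intro x hx z hz h1 h2 h3
            simp only [sub_left_inj] at h1 h2 h3
            ext i; fin_cases i <;> assumption
          · intro x hx; have := hpl x hx; linarith
          · intro x hx; have := hsp x hx; linarith
      · apply circle0 S (fun x => x 0 - m 0) (fun x => x 2 - m 2) (fun x => x 1 - m 1) ?_
          (m 0) (m 2) (m 1) (p 0) (p 2) (p 1) h1 ?_ ?_ lam hlam (hpb _) (hpb _) (hpb _)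
          (hmb _) (hmb _) (hmb _)
        · intro x hx z hz h1 h2 h3
          simp only [sub_left_inj] at h1 h2 h3
          ext i; fin_cases i <;> assumption
        · intro x hx; have := hpl x hx; linarith
        · intro x hx; have := hsp x hx; linarith
    · apply circle0 S (fun x => x 0 - m 0) (fun x => x 1 - m 1) (fun x => x 2 - m 2) ?_
        (m 0) (m 1) (m 2) (p 0) (p 1) (p 2) h2 ?_ ?_ lam hlam (hpb _) (hpb _) (hpb _)
        (hmb _) (hmb _) (hmb _)
      · intro x hx z hz h1 h2 h3
        simp only [sub_left_inj] at h1 h2 h3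
        ext i; fin_cases i <;> assumption
      · intro x hx; have := hpl x hx; linarith
      · intro x hx; have := hsp x hx; linarith
  obtain ⟨M, hMb, hcard⟩ := hM
  have hdb : (M.divisors.card : ℝ) ≤ C * ((10 : ℝ) ^ 9) ^ (ε / 36) * lam ^ (ε / 2) := by
    rcases eq_or_ne M 0 with rfl | h
    · simp; positivity
    · refine (hd M h).trans ?_
      calc C * (M : ℝ) ^ (ε / 36) ≤ C * (10 ^ 9 * lam ^ 18) ^ (ε / 36) := by gcongr
        _ = _ := by
          rw [Real.mul_rpow (by positivity) (by positivity), ← Real.rpow_natCast lam,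
            ← Real.rpow_mul hl0.le]
          rw [mul_assoc]; congr 3; push_cast; ring
  have hle : (1 : ℝ) ≤ lam ^ ε := Real.one_le_rpow hlam hε.le
  have hsq : (lam ^ (ε / 2)) ^ 2 = lam ^ ε := by
    rw [← Real.rpow_natCast, ← Real.rpow_mul hl0.le]; congr 1; push_cast; ring
  calc (S.card : ℝ) ≤ 10 * (M.divisors.card : ℝ) ^ 2 + 1 := by exact_mod_cast hcard
    _ ≤ 10 * (C * ((10 : ℝ) ^ 9) ^ (ε / 36) * lam ^ (ε / 2)) ^ 2 + 2 * lam ^ ε := by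
        gcongr; linarith
    _ = _ := by rw [mul_pow, hsq]; ring

lemma det_small (L lam a1 a2 m1 m2 m3 : ℝ) (hlam : 1 ≤ lam) (hL : 1 ≤ L)
    (hL3 : 125 * L ^ 3 ≤ lam)
    (ha1 : |a1| ≤ 1) (ha2 : |a2| ≤ 1)
    (hm : m1 ^ 2 + m2 ^ 2 + m3 ^ 2 = lam ^ 2)
    (x y z : Fin 3 → ℝ)
    (hx : ∀ i, |x i + a1 * z i| ≤ 1) (hy : ∀ i, |y i + a2 * z i| ≤ 1) (hz : ∀ i, |z i| ≤ L)
    (hs : ∀ i, x i ^ 2 + y i ^ 2 + z i ^ 2 + 2 * (m1 * x i + m2 * y i + m3 * z i) = 0) :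
    |x 0 * (y 1 * z 2 - y 2 * z 1) - y 0 * (x 1 * z 2 - x 2 * z 1) + z 0 * (x 1 * y 2 - x 2 * y 1)| < 1 := by
  have hL0 : 0 ≤ L := by linarith
  obtain ⟨e, he⟩ : ∃ e : Fin 3 → ℝ, ∀ i, e i = x i + a1 * z i := ⟨_, fun _ => rfl⟩
  obtain ⟨f, hf⟩ : ∃ f : Fin 3 → ℝ, ∀ i, f i = y i + a2 * z i := ⟨_, fun _ => rfl⟩
  obtain ⟨q, hq⟩ : ∃ q, q = m3 - a1 * m1 - a2 * m2 := ⟨_, rfl⟩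
  obtain ⟨r, hr⟩ : ∃ r : Fin 3 → ℝ, ∀ i, r i = m1 * e i + m2 * f i + q * z i := ⟨_, fun _ => rfl⟩
  have hx' : ∀ i, x i = e i - a1 * z i := fun i => by rw [he]; ring
  have hy' : ∀ i, y i = f i - a2 * z i := fun i => by rw [hf]; ring
  simp_rw [← he] at hx
  simp_rw [← hf] at hy
  have hrb : ∀ i, |r i| ≤ 5 * L ^ 2 := by
    intro i
    have h1 : r i = - (x i ^ 2 + y i ^ 2 + z i ^ 2) / 2 := by
      rw [hr, he, hf, hq]; linarith [hs i]
    have bx : |x i| ≤ 2 * L := by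
      rw [hx']
      refine (abs_sub _ _).trans ?_
      rw [abs_mul]
      have := hx i
      have : |a1| * |z i| ≤ 1 * L := by gcongr; exact hz i
      linarith
    have bY : |y i| ≤ 2 * L := by
      rw [hy']
      refine (abs_sub _ _).trans ?_
      rw [abs_mul]
      have := hy i
      have : |a2| * |z i| ≤ 1 * L := by gcongr; exact hz i
      linarith
    have b1 := sq_le_sq' (abs_le.1 bx).1 (abs_le.1 bx).2
    have b2 := sq_le_sq' (abs_le.1 bY).1 (abs_le.1 bY).2
    have b3 := sq_le_sq' (abs_le.1 (hz i)).1 (abs_le.1 (hz i)).2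
    rw [h1, abs_le]
    constructor <;> nlinarith [sq_nonneg (x i), sq_nonneg (y i), sq_nonneg (z i)]
  have det3 : ∀ (u v w : Fin 3 → ℝ), (∀ i, |u i| ≤ 5 * L ^ 2) → (∀ i, |v i| ≤ 1) →
      (∀ i, |w i| ≤ L) → 
      |u 0 * (v 1 * w 2 - v 2 * w 1) - v 0 * (u 1 * w 2 - u 2 * w 1)
        + w 0 * (u 1 * v 2 - u 2 * v 1)| ≤ 30 * L ^ 3 := by
    intro u v w hu hv hw
    have t : ∀ i j k, |u i * v j * w k| ≤ 5 * L ^ 3 := by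
      intro i j k
      rw [abs_mul, abs_mul]
      calc _ ≤ 5 * L ^ 2 * 1 * L := by
            gcongr
            exacts [hu i, hv j, hw k]
        _ = _ := by ring
    have t1 := abs_le.1 (t 0 1 2)
    have t2 := abs_le.1 (t 0 2 1)
    have t3 := abs_le.1 (t 1 0 2)
    have t4 := abs_le.1 (t 2 0 1)
    have t5 := abs_le.1 (t 1 2 0)
    have t6 := abs_le.1 (t 2 1 0)
    rw [abs_le]; constructor <;> linarith
  obtain ⟨d, hd⟩ : ∃ d, d = x 0 * (y 1 * z 2 - y 2 * z 1) - y 0 * (x 1 * z 2 - x 2 * z 1) + z 0 * (x 1 * y 2 - x 2 * y 1) := ⟨_, rfl⟩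
  rw [← hd]
  have k1 : |m1 * d| ≤ 30 * L ^ 3 := by
    have := det3 r f z hrb hy hz
    convert this using 2
    rw [hd]; simp only [hr, hx', hy']; ring
  have k2 : |m2 * d| ≤ 30 * L ^ 3 := by
    have := det3 r e z hrb hx hz
    rw [← abs_neg] at this
    convert this using 2
    rw [hd]; simp only [hr, hx', hy']; ring
  have k3 : |q * d| ≤ 30 * L ^ 3 := by
    have := det3 r e f hrb hx (fun i => (hy i).trans hL)
    convert this using 2
    rw [hd]; simp only [hr, hx', hy']; ring
  rw [abs_mul] at k1 k2 k3
  by_contra hcon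
  push Not at hcon
  have hpos : 0 < L ^ 3 := by positivity
  have j1 : |m1| ≤ 30 * L ^ 3 := by nlinarith [abs_nonneg m1]
  have j2 : |m2| ≤ 30 * L ^ 3 := by nlinarith [abs_nonneg m2]
  have j3 : |q| ≤ 30 * L ^ 3 := by nlinarith [abs_nonneg q]
  have l1 : |m1| < lam / 4 := by linarith
  have l2 : |m2| < lam / 4 := by linarith
  have l3 : |q| < lam / 4 := by linarith
  have l4 : |m3| ≤ 3 * (lam / 4) := by
    have : m3 = q + a1 * m1 + a2 * m2 := by rw [hq]; ring
    rw [this]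
    refine (abs_add_le _ _).trans ?_
    have := abs_add_le q (a1 * m1)
    rw [abs_mul] at this ⊢
    have : |a1| * |m1| ≤ 1 * (lam / 4) := by gcongr
    have : |a2| * |m2| ≤ 1 * (lam / 4) := by gcongr
    linarith
  have s1 := sq_le_sq' (abs_le.1 l1.le).1 (abs_le.1 l1.le).2
  have s2 := sq_le_sq' (abs_le.1 l2.le).1 (abs_le.1 l2.le).2
  have s3 := sq_le_sq' (abs_le.1 l4).1 (abs_le.1 l4).2
  nlinarith

lemma not_collinear (m d d' : Fin 3 → ℤ)
    (h1 : d 0 ^ 2 + d 1 ^ 2 + d 2 ^ 2 + 2 * (m 0 * d 0 + m 1 * d 1 + m 2 * d 2) = 0)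
    (h2 : d' 0 ^ 2 + d' 1 ^ 2 + d' 2 ^ 2 + 2 * (m 0 * d' 0 + m 1 * d' 1 + m 2 * d' 2) = 0)
    (hd : d ≠ 0) (hd' : d' ≠ 0)
    (c0 : d 1 * d' 2 - d 2 * d' 1 = 0) (c1 : d 2 * d' 0 - d 0 * d' 2 = 0)
    (c2 : d 0 * d' 1 - d 1 * d' 0 = 0) : d = d' := by
  have pos : ∀ v : Fin 3 → ℤ, v ≠ 0 → v 0 ^ 2 + v 1 ^ 2 + v 2 ^ 2 ≠ 0 := by
    intro v hv h
    apply hv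
    have e0 : v 0 ^ 2 = 0 := by nlinarith [sq_nonneg (v 0), sq_nonneg (v 1), sq_nonneg (v 2)]
    have e1 : v 1 ^ 2 = 0 := by nlinarith [sq_nonneg (v 0), sq_nonneg (v 1), sq_nonneg (v 2)]
    have e2 : v 2 ^ 2 = 0 := by nlinarith [sq_nonneg (v 0), sq_nonneg (v 1), sq_nonneg (v 2)]
    ext i; fin_cases i
    · simpa using e0
    · simpa using e1
    · simpa using e2
  have p1 := pos d hd
  have p2 := pos d' hd'
  set I := d 0 * d' 0 + d 1 * d' 1 + d 2 * d' 2 with hI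
  set N := d 0 ^ 2 + d 1 ^ 2 + d 2 ^ 2 with hN
  set N' := d' 0 ^ 2 + d' 1 ^ 2 + d' 2 ^ 2 with hN'
  have a0 : N * d' 0 = I * d 0 := by rw [hN, hI]; linear_combination (-d 1) * c2 + d 2 * c1
  have a1 : N * d' 1 = I * d 1 := by rw [hN, hI]; linear_combination (d 0) * c2 - d 2 * c0
  have a2 : N * d' 2 = I * d 2 := by rw [hN, hI]; linear_combination (-d 0) * c1 + d 1 * c0
  have b0 : N' * d 0 = I * d' 0 := by rw [hN', hI]; linear_combination (d' 1) * c2 - d' 2 * c1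
  have b1 : N' * d 1 = I * d' 1 := by rw [hN', hI]; linear_combination (-d' 0) * c2 + d' 2 * c0
  have b2 : N' * d 2 = I * d' 2 := by rw [hN', hI]; linear_combination (d' 0) * c1 - d' 1 * c0
  have e1 : N' = I := by
    apply mul_left_cancel₀ p1
    linear_combination N * h2 - I * h1 - 2 * m 0 * a0 - 2 * m 1 * a1 - 2 * m 2 * a2
  have e2 : N = I := by
    apply mul_left_cancel₀ p2
    linear_combination N' * h1 - I * h2 - 2 * m 0 * b0 - 2 * m 1 * b1 - 2 * m 2 * b2
  rw [e2] at a0 a1 a2 p1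
  ext i; fin_cases i
  · exact (mul_left_cancel₀ p1 a0).symm
  · exact (mul_left_cancel₀ p1 a1).symm
  · exact (mul_left_cancel₀ p1 a2).symm

lemma piece_count (ε : ℝ) (hε : 0 < ε) : ∃ C : ℝ, 2 ≤ C ∧
    ∀ (S : Finset (Fin 3 → ℤ)) (lam a1 a2 L : ℝ), 1 ≤ lam → |a1| ≤ 1 → |a2| ≤ 1 →
    125 * L ^ 3 ≤ lam →
    (∀ x ∈ S, (x 0 : ℝ) ^ 2 + (x 1 : ℝ) ^ 2 + (x 2 : ℝ) ^ 2 = lam ^ 2) →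
    (∀ x ∈ S, ∀ y ∈ S, |((x 0 : ℝ) - y 0) + a1 * ((x 2 : ℝ) - y 2)| < 1) →
    (∀ x ∈ S, ∀ y ∈ S, |((x 1 : ℝ) - y 1) + a2 * ((x 2 : ℝ) - y 2)| < 1) →
    (∀ x ∈ S, ∀ y ∈ S, |(x 2 : ℝ) - y 2| ≤ L) →
    (S.card : ℝ) ≤ C * lam ^ ε := by
  obtain ⟨C, hC, hcirc⟩ := circle_count ε hε
  refine ⟨C, hC, ?_⟩
  intro S lam a1 a2 L hlam ha1 ha2 hL3 hsp he1 he2 hz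
  have hl0 : 0 < lam := by linarith
  have hle : (1 : ℝ) ≤ lam ^ ε := Real.one_le_rpow hlam hε.le
  by_cases hcard : S.card ≤ 2
  · have : (S.card : ℝ) ≤ 2 := by exact_mod_cast hcard
    nlinarith
  push Not at hcard
  obtain ⟨m, n, n', hm, hn, hn', hmn, hmn', hnn'⟩ := Finset.two_lt_card_iff.1 hcard
  have hL : 1 ≤ L := by
    by_contra hL
    push Not at hL
    apply hmn
    have h2 : m 2 = n 2 := by
      have := (hz m hm n hn).trans_lt hL
      have h : |m 2 - n 2| < 1 := by exact_mod_cast this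
      rw [Int.abs_lt_one_iff] at h; omega
    have h0 : m 0 = n 0 := by
      have := he1 m hm n hn
      rw [h2, sub_self, mul_zero, add_zero] at this
      have h : |m 0 - n 0| < 1 := by exact_mod_cast this
      rw [Int.abs_lt_one_iff] at h; omega
    have h1 : m 1 = n 1 := by
      have := he2 m hm n hn
      rw [h2, sub_self, mul_zero, add_zero] at this
      have h : |m 1 - n 1| < 1 := by exact_mod_cast this
      rw [Int.abs_lt_one_iff] at h; omega
    ext i; fin_cases i <;> assumption
  have hspR : ∀ x ∈ S, ((x 0 : ℝ) - m 0) ^ 2 + ((x 1 : ℝ) - m 1) ^ 2 + ((x 2 : ℝ) - m 2) ^ 2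
      + 2 * (m 0 * ((x 0 : ℝ) - m 0) + m 1 * ((x 1 : ℝ) - m 1) + m 2 * ((x 2 : ℝ) - m 2)) = 0 := by
    intro x hx
    have h1 := hsp x hx
    have h2 := hsp m hm
    linarith
  have hspZ : ∀ x ∈ S, (x 0 - m 0) ^ 2 + (x 1 - m 1) ^ 2 + (x 2 - m 2) ^ 2
      + 2 * (m 0 * (x 0 - m 0) + m 1 * (x 1 - m 1) + m 2 * (x 2 - m 2)) = 0 := by
    intro x hx
    exact_mod_cast hspR x hx
  have hcb : ∀ x ∈ S, ∀ i, |(x i : ℝ)| ≤ lam := by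
    intro x hx i
    have h := hsp x hx
    apply abs_le_of_sq_le_sq _ hl0.le
    fin_cases i
    · show (x 0 : ℝ) ^ 2 ≤ _
      nlinarith [sq_nonneg (x 0 : ℝ), sq_nonneg (x 1 : ℝ), sq_nonneg (x 2 : ℝ)]
    · show (x 1 : ℝ) ^ 2 ≤ _
      nlinarith [sq_nonneg (x 0 : ℝ), sq_nonneg (x 1 : ℝ), sq_nonneg (x 2 : ℝ)]
    · show (x 2 : ℝ) ^ 2 ≤ _
      nlinarith [sq_nonneg (x 0 : ℝ), sq_nonneg (x 1 : ℝ), sq_nonneg (x 2 : ℝ)]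
  have hdb : ∀ x ∈ S, ∀ i, |(x i : ℝ) - m i| ≤ 2 * lam := by
    intro x hx i
    have := abs_sub (x i : ℝ) (m i)
    linarith [hcb x hx i, hcb m hm i]
  have crossb : ∀ i j, |((n i : ℝ) - m i) * ((n' j : ℝ) - m j) - ((n j : ℝ) - m j) * ((n' i : ℝ) - m i)|
      ≤ 8 * lam ^ 2 := by
    intro i j
    refine (abs_sub _ _).trans ?_
    rw [abs_mul, abs_mul]
    calc _ ≤ (2 * lam) * (2 * lam) + (2 * lam) * (2 * lam) := by
          gcongr
          exacts [hdb n hn i, hdb n' hn' j, hdb n hn j, hdb n' hn' i]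
      _ = _ := by ring
  apply hcirc S m ![(n 1 - m 1) * (n' 2 - m 2) - (n 2 - m 2) * (n' 1 - m 1),
    (n 2 - m 2) * (n' 0 - m 0) - (n 0 - m 0) * (n' 2 - m 2),
    (n 0 - m 0) * (n' 1 - m 1) - (n 1 - m 1) * (n' 0 - m 0)] lam hlam
  · intro h
    have c0 := congrFun h 0
    have c1 := congrFun h 1
    have c2 := congrFun h 2
    simp only [Matrix.cons_val, Pi.zero_apply] at c0 c1 c2
    have := not_collinear m (n - m) (n' - m) (hspZ n hn) (hspZ n' hn')
      (sub_ne_zero.2 hmn.symm) (sub_ne_zero.2 hmn'.symm) c0 c1 c2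
    exact hnn' (sub_left_injective this)
  · intro x hx
    have hin : ∀ i : Fin 3, (![x, n, n'] i) ∈ S := by
      intro i; fin_cases i <;> simpa
    have := det_small L lam a1 a2 (m 0) (m 1) (m 2) hlam hL hL3 ha1 ha2 (hsp m hm)
      (fun i => ((![x, n, n'] i) 0 : ℝ) - m 0) (fun i => ((![x, n, n'] i) 1 : ℝ) - m 1)
      (fun i => ((![x, n, n'] i) 2 : ℝ) - m 2)
      (fun i => (he1 _ (hin i) m hm).le) (fun i => (he2 _ (hin i) m hm).le)
      (fun i => hz _ (hin i) m hm) (fun i => hspR _ (hin i))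
    simp only [Matrix.cons_val] at this
    have h : |(x 0 - m 0) * ((n 1 - m 1) * (n' 2 - m 2) - (n' 1 - m 1) * (n 2 - m 2))
      - (x 1 - m 1) * ((n 0 - m 0) * (n' 2 - m 2) - (n' 0 - m 0) * (n 2 - m 2))
      + (x 2 - m 2) * ((n 0 - m 0) * (n' 1 - m 1) - (n' 0 - m 0) * (n 1 - m 1))| < 1 := by
      exact_mod_cast this
    rw [Int.abs_lt_one_iff] at h
    simp only [Matrix.cons_val]
    linarith
  · exact hspZ
  · intro i
    fin_cases i
    · simpa using crossb 1 2
    · simpa using crossb 2 0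
    · simpa using crossb 0 1
  · exact hcb m hm

set_option maxHeartbeats 2000000 in
lemma cell_count (ε : ℝ) (hε : 0 < ε) : ∃ C : ℝ, 0 < C ∧
    ∀ (S : Finset (Fin 3 → ℤ)) (lam a1 a2 : ℝ), 1 ≤ lam → |a1| ≤ 1 → |a2| ≤ 1 →
    (∀ x ∈ S, (x 0 : ℝ) ^ 2 + (x 1 : ℝ) ^ 2 + (x 2 : ℝ) ^ 2 = lam ^ 2) →
    (∀ x ∈ S, ∀ y ∈ S, |((x 0 : ℝ) - y 0) + a1 * ((x 2 : ℝ) - y 2)| < 1) →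
    (∀ x ∈ S, ∀ y ∈ S, |((x 1 : ℝ) - y 1) + a2 * ((x 2 : ℝ) - y 2)| < 1) →
    (S.card : ℝ) ≤ C * lam ^ ((1 : ℝ) / 6 + ε) := by
  obtain ⟨C, hC, hpiece⟩ := piece_count ε hε
  refine ⟨82 * C, by linarith, ?_⟩
  intro S lam a1 a2 hlam ha1 ha2 hsp he1 he2
  have hl0 : 0 < lam := by linarith
  rcases S.eq_empty_or_nonempty with rfl | ⟨m, hm⟩
  · simp; positivity
  obtain ⟨L, hL⟩ : ∃ L, L = lam ^ ((1 : ℝ) / 3) / 5 := ⟨_, rfl⟩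
  have hL0 : 0 < L := by rw [hL]; positivity
  have hL3 : 125 * L ^ 3 ≤ lam := by
    rw [hL, div_pow, ← Real.rpow_natCast, ← Real.rpow_mul hl0.le]
    norm_num
    linarith
  obtain ⟨W, hW⟩ : ∃ W, W = 4 * lam ^ ((1 : ℝ) / 2) := ⟨_, rfl⟩
  have hW0 : 0 < W := by rw [hW]; positivity
  have hW2 : W ^ 2 = 16 * lam := by
    rw [hW, mul_pow, ← Real.rpow_natCast (lam ^ _), ← Real.rpow_mul hl0.le]
    norm_num
  have hWL : 2 * W / L = 40 * lam ^ ((1 : ℝ) / 6) := by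
    rw [div_eq_iff hL0.ne', hW, hL]
    have : lam ^ ((1 : ℝ) / 2) = lam ^ ((1 : ℝ) / 6) * lam ^ ((1 : ℝ) / 3) := by
      rw [← Real.rpow_add hl0]; norm_num
    rw [this]; ring
  obtain ⟨A, hA⟩ : ∃ A, A = 1 + a1 ^ 2 + a2 ^ 2 := ⟨_, rfl⟩
  have hA1 : 1 ≤ A := by rw [hA]; nlinarith [sq_nonneg a1, sq_nonneg a2]
  obtain ⟨q, hq⟩ : ∃ q, q = (m 2 : ℝ) - a1 * m 0 - a2 * m 1 := ⟨_, rfl⟩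
  have hcb : ∀ x ∈ S, |(x 0 : ℝ)| ≤ lam ∧ |(x 1 : ℝ)| ≤ lam ∧ |(x 2 : ℝ)| ≤ lam := by
    intro x hx
    have h := hsp x hx
    refine ⟨?_, ?_, ?_⟩ <;> apply abs_le_of_sq_le_sq _ hl0.le <;> 
      nlinarith [sq_nonneg (x 0 : ℝ), sq_nonneg (x 1 : ℝ), sq_nonneg (x 2 : ℝ)]
  have htwo : ∀ x ∈ S, |(x 2 : ℝ) - m 2| ≤ W ∨ |(x 2 : ℝ) - m 2 + 2 * q / A| ≤ W := by
    intro x hx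
    obtain ⟨z, hz⟩ : ∃ z, z = (x 2 : ℝ) - m 2 := ⟨_, rfl⟩
    obtain ⟨e, he⟩ : ∃ e, e = ((x 0 : ℝ) - m 0) + a1 * ((x 2 : ℝ) - m 2) := ⟨_, rfl⟩
    obtain ⟨f, hf⟩ : ∃ f, f = ((x 1 : ℝ) - m 1) + a2 * ((x 2 : ℝ) - m 2) := ⟨_, rfl⟩
    have eb := (he1 x hx m hm).le
    have fb := (he2 x hx m hm).le
    rw [← he] at eb
    rw [← hf] at fb
    have h1 := hsp x hx
    have h2 := hsp m hm
    have key : z * (A * z + 2 * q) = 2 * (a1 * e) * z + 2 * (a2 * f) * z - 2 * m 0 * e - 2 * m 1 * f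
        - e ^ 2 - f ^ 2 := by
      rw [hz, he, hf, hA, hq]; linear_combination h1 - h2
    have zb : |z| ≤ 2 * lam := by
      rw [hz]
      have := abs_sub (x 2 : ℝ) (m 2)
      linarith [(hcb x hx).2.2, (hcb m hm).2.2]
    have t1 : |(a1 * e) * z| ≤ 2 * lam := by
      rw [abs_mul, abs_mul]
      calc _ ≤ 1 * 1 * (2 * lam) := by gcongr
        _ = _ := by ring
    have t2 : |(a2 * f) * z| ≤ 2 * lam := by
      rw [abs_mul, abs_mul]
      calc _ ≤ 1 * 1 * (2 * lam) := by gcongr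
        _ = _ := by ring
    have t3 : |(m 0 : ℝ) * e| ≤ lam := by
      rw [abs_mul]
      calc _ ≤ lam * 1 := by gcongr; exact (hcb m hm).1
        _ = _ := by ring
    have t4 : |(m 1 : ℝ) * f| ≤ lam := by
      rw [abs_mul]
      calc _ ≤ lam * 1 := by gcongr; exact (hcb m hm).2.1
        _ = _ := by ring
    have t5 : e ^ 2 ≤ 1 := by rw [← sq_abs]; nlinarith [abs_nonneg e]
    have t6 : f ^ 2 ≤ 1 := by rw [← sq_abs]; nlinarith [abs_nonneg f]
    have hb : |z * (A * z + 2 * q)| ≤ 14 * lam := by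
      rw [key]
      have t1 := abs_le.1 t1
      have t2 := abs_le.1 t2
      have t3 := abs_le.1 t3
      have t4 := abs_le.1 t4
      rw [abs_le]
      constructor <;> linarith [sq_nonneg e, sq_nonneg f]
    rw [← hz]
    by_contra hcon
    push Not at hcon
    obtain ⟨c1, c2⟩ := hcon
    have : A * z + 2 * q = A * (z + 2 * q / A) := by field_simp
    rw [this, abs_mul, abs_mul, abs_of_pos (by linarith : 0 < A)] at hb
    have c3 : W ≤ A * |z + 2 * q / A| :=
      c2.le.trans (le_mul_of_one_le_left (abs_nonneg _) hA1)
    have c4 : W * W ≤ |z| * (A * |z + 2 * q / A|) := by gcongr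
    have c5 : W * W = 16 * lam := by rw [← sq]; exact hW2
    linarith
  classical
  obtain ⟨ctr, hctr⟩ : ∃ ctr : Bool → ℝ, ctr true = m 2 ∧ ctr false = m 2 - 2 * q / A :=
    ⟨fun b => if b then m 2 else m 2 - 2 * q / A, by simp⟩
  have hb : ∀ x ∈ S, ∃ b : Bool, |(x 2 : ℝ) - ctr b| ≤ W := by
    intro x hx
    rcases htwo x hx with h | h
    · exact ⟨true, by rw [hctr.1]; exact h⟩
    · refine ⟨false, ?_⟩
      rw [hctr.2]; convert h using 2; ring
  choose! b hb using hb
  have hmain := Finset.card_le_mul_card_image_of_maps_to (s := S)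
    (t := (Finset.univ : Finset Bool) ×ˢ Finset.range (⌊2 * W / L⌋₊ + 1))
    (f := fun x => (b x, ⌊((x 2 : ℝ) - ctr (b x) + W) / L⌋₊)) ?_ ⌊C * lam ^ ε⌋₊ ?_
  · rw [Finset.card_product] at hmain
    simp only [Finset.card_univ, Fintype.card_bool, Finset.card_range] at hmain
    have h1 : (S.card : ℝ) ≤ (⌊C * lam ^ ε⌋₊ : ℝ) * (2 * ((⌊2 * W / L⌋₊ : ℝ) + 1)) := by
      exact_mod_cast hmain
    have h2 : (⌊C * lam ^ ε⌋₊ : ℝ) ≤ C * lam ^ ε := Nat.floor_le (by positivity)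
    have h3 : (⌊2 * W / L⌋₊ : ℝ) ≤ 40 * lam ^ ((1 : ℝ) / 6) := by
      rw [← hWL]; exact Nat.floor_le (by positivity)
    have h4 : (1 : ℝ) ≤ lam ^ ((1 : ℝ) / 6) := Real.one_le_rpow hlam (by norm_num)
    calc (S.card : ℝ) ≤ _ := h1
      _ ≤ C * lam ^ ε * (2 * (40 * lam ^ ((1 : ℝ) / 6) + lam ^ ((1 : ℝ) / 6))) := by gcongr
      _ = 82 * C * lam ^ ((1 : ℝ) / 6 + ε) := by rw [Real.rpow_add hl0]; ring
  · intro x hx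
    simp only [Finset.mem_product, Finset.mem_univ, true_and, Finset.mem_range]
    rw [Nat.lt_succ_iff]
    apply Nat.floor_le_floor
    have := (abs_le.1 (hb x hx)).2
    gcongr
    linarith
  · rintro ⟨b0, k⟩ hk
    apply Nat.le_floor
    have hin : ∀ x ∈ S.filter (fun x => (b x, ⌊((x 2 : ℝ) - ctr (b x) + W) / L⌋₊) = (b0, k)),
        x ∈ S ∧ L * k ≤ (x 2 : ℝ) - ctr b0 + W ∧ (x 2 : ℝ) - ctr b0 + W ≤ L * (k + 1) := by
      intro x hx
      rw [Finset.mem_filter, Prod.mk.injEq] at hx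
      obtain ⟨hx, hx1, hx2⟩ := hx
      have h0 := (abs_le.1 (hb x hx)).1
      rw [hx1] at hx2 h0
      refine ⟨hx, ?_, ?_⟩
      · have := Nat.floor_le (div_nonneg (by linarith : 0 ≤ (x 2 : ℝ) - ctr b0 + W) hL0.le)
        rw [hx2, le_div_iff₀ hL0] at this
        linarith
      · have := (Nat.lt_floor_add_one (((x 2 : ℝ) - ctr b0 + W) / L)).le
        rw [hx2, div_le_iff₀ hL0] at this
        linarith
    apply hpiece _ lam a1 a2 L hlam ha1 ha2 hL3
    · exact fun x hx => hsp x (hin x hx).1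
    · exact fun x hx y hy => he1 x (hin x hx).1 y (hin y hy).1
    · exact fun x hx y hy => he2 x (hin x hx).1 y (hin y hy).1
    · intro x hx y hy
      obtain ⟨-, u1, u2⟩ := hin x hx
      obtain ⟨-, v1, v2⟩ := hin y hy
      rw [abs_le]; constructor <;> linarith

lemma gauss_bound {α : Type*} (E : Finset α) (c : α → ℂ) (θ₁ θ₂ : α → ℝ) :
    (∫ t in Set.univ.pi (fun _ : Fin 2 => Set.Icc (-1 : ℝ) 1),
      ‖∑ n ∈ E, c n * Complex.exp (Complex.I * (θ₁ n * t 0 + θ₂ n * t 1))‖ ^ 2) ≤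
    Real.exp 2 * Real.pi * ∑ m ∈ E, ∑ n ∈ E, ‖c m‖ * ‖c n‖ *
      Real.exp (-((θ₁ m - θ₁ n) ^ 2 + (θ₂ m - θ₂ n) ^ 2) / 4) := by
  set f : (Fin 2 → ℝ) → ℂ := fun t =>
    ∑ n ∈ E, c n * Complex.exp (Complex.I * (θ₁ n * t 0 + θ₂ n * t 1)) with hf
  have hfc : Continuous f := by rw [hf]; fun_prop
  obtain ⟨δ, hδ⟩ : ∃ δ : α → α → Fin 2 → ℂ, ∀ m n, δ m n =
    ![Complex.I * (θ₁ m - θ₁ n), Complex.I * (θ₂ m - θ₂ n)] := ⟨_, fun _ _ => rfl⟩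
  set G : (Fin 2 → ℝ) → ℂ := fun t => ∑ m ∈ E, ∑ n ∈ E, c m * (starRingEnd ℂ) (c n) *
    Complex.exp (-1 * ∑ i, (t i : ℂ) ^ 2 + ∑ i, δ m n i * t i) with hG
  have hb : 0 < (1 : ℂ).re := by simp
  have hint : ∀ m n, Integrable (fun t : Fin 2 → ℝ => c m * (starRingEnd ℂ) (c n) *
    Complex.exp (-1 * ∑ i, (t i : ℂ) ^ 2 + ∑ i, δ m n i * t i)) := fun m n =>
      (GaussianFourier.integrable_cexp_neg_mul_sum_add hb (δ m n)).const_mul _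
  have hGint : Integrable G := 
    integrable_finsetSum _ fun m _ => integrable_finsetSum _ fun n _ => hint m n
  set F : (Fin 2 → ℝ) → ℝ := fun t => ‖f t‖ ^ 2 * Real.exp (-(t 0 ^ 2 + t 1 ^ 2)) with hF
  have hFG : ∀ t, (F t : ℂ) = G t := by
    intro t
    simp only [hF, hG]
    push_cast
    rw [← Complex.mul_conj' (f t)]
    simp only [hf, map_sum, map_mul, Finset.sum_mul_sum]
    rw [Finset.sum_mul]
    apply Finset.sum_congr rfl; intro m _
    rw [Finset.sum_mul]
    apply Finset.sum_congr rfl; intro n _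
    rw [← Complex.exp_conj]
    have : ∀ a b u v w : ℂ, a * Complex.exp u * (b * Complex.exp v) * Complex.exp w = 
        a * b * Complex.exp (u + v + w) := by
      intro a b u v w; rw [Complex.exp_add, Complex.exp_add]; ring
    rw [this]
    congr 2
    simp only [hδ, Fin.sum_univ_two, map_mul, map_add, Complex.conj_I, Complex.conj_ofReal]
    simp
    ring
  have hFint : Integrable F := by
    have h1 : Integrable (fun t => (F t : ℂ)) := by
      simp_rw [hFG]; exact hGint
    exact h1.re
  have hF0 : ∀ t, 0 ≤ F t := fun t => by simp only [hF]; positivity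
  have hmeas : MeasurableSet (Set.univ.pi (fun _ : Fin 2 => Set.Icc (-1 : ℝ) 1)) :=
    MeasurableSet.univ_pi fun _ => measurableSet_Icc
  have hcomp : IsCompact (Set.univ.pi (fun _ : Fin 2 => Set.Icc (-1 : ℝ) 1)) :=
    isCompact_univ_pi fun _ => isCompact_Icc
  have step1 : (∫ t in Set.univ.pi (fun _ : Fin 2 => Set.Icc (-1 : ℝ) 1), ‖f t‖ ^ 2) ≤
      ∫ t in Set.univ.pi (fun _ : Fin 2 => Set.Icc (-1 : ℝ) 1), Real.exp 2 * F t := by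
    apply setIntegral_mono_on _ _ hmeas
    · intro t ht
      have h0 := ht 0 (Set.mem_univ _)
      have h1 := ht 1 (Set.mem_univ _)
      simp only [Set.mem_Icc] at h0 h1
      have e : Real.exp 2 * F t = ‖f t‖ ^ 2 * Real.exp (2 - (t 0 ^ 2 + t 1 ^ 2)) := by
        simp only [hF]
        rw [sub_eq_add_neg, Real.exp_add]; ring
      rw [e]
      have : 1 ≤ Real.exp (2 - (t 0 ^ 2 + t 1 ^ 2)) := by
        apply Real.one_le_exp; nlinarith
      nlinarith [sq_nonneg ‖f t‖]
    · exact (by fun_prop : Continuous fun t => ‖f t‖ ^ 2).continuousOn.integrableOn_compact hcomp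
    · exact (hFint.const_mul _).integrableOn
  have step2 : ∫ t in Set.univ.pi (fun _ : Fin 2 => Set.Icc (-1 : ℝ) 1), Real.exp 2 * F t
      ≤ ∫ t, Real.exp 2 * F t :=
    setIntegral_le_integral (hFint.const_mul _)
      (Filter.Eventually.of_forall fun t => mul_nonneg (Real.exp_pos _).le (hF0 t))
  refine step1.trans (step2.trans ?_)
  rw [integral_const_mul, mul_assoc]
  gcongr
  have h3 : ((∫ t, F t : ℝ) : ℂ) = ∫ t, G t := by
    rw [← integral_complex_ofReal]
    congr 1; ext t; exact hFG t
  have h4 : ∫ t, F t ≤ ‖∫ t, G t‖ := by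
    rw [← h3, Complex.norm_real]; exact le_abs_self _
  refine h4.trans ?_
  have h5 : ∫ t, G t = ∑ m ∈ E, ∑ n ∈ E, c m * (starRingEnd ℂ) (c n) *
      (Real.pi * Real.exp (-((θ₁ m - θ₁ n) ^ 2 + (θ₂ m - θ₂ n) ^ 2) / 4) : ℝ) := by
    simp only [hG]
    rw [integral_finsetSum _ fun m _ => integrable_finsetSum _ fun n _ => hint m n]
    apply Finset.sum_congr rfl; intro m _
    rw [integral_finsetSum _ fun n _ => hint m n]
    apply Finset.sum_congr rfl; intro n _
    rw [integral_const_mul, GaussianFourier.integral_cexp_neg_mul_sum_add hb]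
    congr 1
    push_cast
    congr 1
    · simp
    · congr 1
      simp only [hδ, Fin.sum_univ_two]
      simp [mul_pow]
      ring
  rw [h5, Finset.mul_sum]
  refine (norm_sum_le _ _).trans (Finset.sum_le_sum fun m _ => ?_)
  rw [Finset.mul_sum]
  refine (norm_sum_le _ _).trans (Finset.sum_le_sum fun n _ => le_of_eq ?_)
  rw [norm_mul, norm_mul, Complex.norm_real, Real.norm_of_nonneg (by positivity), RCLike.norm_conj]
  ring

lemma summable_w : Summable (fun k : ℤ => 12 / (1 + (k : ℝ) ^ 2)) := by
  have h1 : Summable (fun k : ℤ => 1 / (k : ℝ) ^ 2) := Real.summable_one_div_int_pow.2 (by norm_num)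
  have h2 : Summable (fun k : ℤ => if k = 0 then (1 : ℝ) else 0) := (hasSum_ite_eq (0 : ℤ) (1 : ℝ)).summable
  refine Summable.of_nonneg_of_le (fun k => by positivity) (fun k => ?_) ((h1.add h2).mul_left 12)
  rcases eq_or_ne k 0 with rfl | h
  · simp
  · simp only [h, if_false, add_zero]
    have : 0 < (k : ℝ) ^ 2 := by positivity
    rw [mul_one_div]
    gcongr
    linarith

lemma exp_floor_le (ξ : ℝ) : Real.exp (-ξ ^ 2 / 4) ≤ 12 / (1 + ((⌊ξ⌋ : ℤ) : ℝ) ^ 2) := by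
  have h1 := Int.floor_le ξ
  have h2 := Int.lt_floor_add_one ξ
  set k : ℝ := ((⌊ξ⌋ : ℤ) : ℝ)
  have h3 : 1 + ξ ^ 2 / 4 ≤ Real.exp (ξ ^ 2 / 4) := by linarith [Real.add_one_le_exp (ξ ^ 2 / 4)]
  have h4 : -ξ ^ 2 / 4 = -(ξ ^ 2 / 4) := by ring
  rw [h4, Real.exp_neg, ← one_div, div_le_div_iff₀ (by positivity) (by positivity)]
  have h5 : k ^ 2 ≤ 2 * ξ ^ 2 + 2 := by
    have : (ξ - k) ^ 2 ≤ 1 := by nlinarith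
    nlinarith [sq_nonneg (ξ + (ξ - k)), sq_nonneg (2 * ξ - k)]
  nlinarith

lemma schur_row {α : Type*} (E : Finset α) (θ₁ θ₂ : α → ℝ) (B : ℝ) (hB : 0 ≤ B)
    (hcell : ∀ S ⊆ E, (∀ x ∈ S, ∀ y ∈ S, |θ₁ x - θ₁ y| < 1) → (∀ x ∈ S, ∀ y ∈ S, |θ₂ x - θ₂ y| < 1) →
      (S.card : ℝ) ≤ B) (m : α) :
    ∑ n ∈ E, Real.exp (-((θ₁ m - θ₁ n) ^ 2 + (θ₂ m - θ₂ n) ^ 2) / 4) ≤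
      B * (∑' k : ℤ, 12 / (1 + (k : ℝ) ^ 2)) ^ 2 := by
  classical
  set w : ℤ → ℝ := fun k => 12 / (1 + (k : ℝ) ^ 2) with hw
  have hw0 : ∀ k, 0 ≤ w k := fun k => by simp only [hw]; positivity
  set κ₁ : α → ℤ := fun n => ⌊θ₁ n - θ₁ m⌋ with hκ₁
  set κ₂ : α → ℤ := fun n => ⌊θ₂ n - θ₂ m⌋ with hκ₂
  have hle : ∀ n, Real.exp (-((θ₁ m - θ₁ n) ^ 2 + (θ₂ m - θ₂ n) ^ 2) / 4) ≤ w (κ₁ n) * w (κ₂ n) := by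
    intro n
    have e : -((θ₁ m - θ₁ n) ^ 2 + (θ₂ m - θ₂ n) ^ 2) / 4 =
      -(θ₁ n - θ₁ m) ^ 2 / 4 + -(θ₂ n - θ₂ m) ^ 2 / 4 := by ring
    rw [e, Real.exp_add]
    exact mul_le_mul (exp_floor_le _) (exp_floor_le _) (Real.exp_pos _).le (hw0 _)
  have hfl : ∀ a b : ℝ, ∀ k : ℤ, ⌊a⌋ = k → ⌊b⌋ = k → |a - b| < 1 := by
    intro a b k ha hb
    exact Int.abs_sub_lt_one_of_floor_eq_floor (ha.trans hb.symm)
  calc _ ≤ ∑ n ∈ E, w (κ₁ n) * w (κ₂ n) := Finset.sum_le_sum fun n _ => hle n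
    _ = ∑ k ∈ E.image κ₁ ×ˢ E.image κ₂, ∑ n ∈ E with (κ₁ n, κ₂ n) = k, w (κ₁ n) * w (κ₂ n) := by
        rw [Finset.sum_fiberwise_of_maps_to]
        intro n hn
        exact Finset.mem_product.2 ⟨Finset.mem_image_of_mem _ hn, Finset.mem_image_of_mem _ hn⟩
    _ ≤ ∑ k ∈ E.image κ₁ ×ˢ E.image κ₂, B * (w k.1 * w k.2) := by
        apply Finset.sum_le_sum
        rintro ⟨k₁, k₂⟩ _
        have : ∑ n ∈ E with (κ₁ n, κ₂ n) = (k₁, k₂), w (κ₁ n) * w (κ₂ n) =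
            ∑ n ∈ E with (κ₁ n, κ₂ n) = (k₁, k₂), w k₁ * w k₂ := by
          apply Finset.sum_congr rfl
          intro n hn
          have := (Finset.mem_filter.1 hn).2
          rw [Prod.mk.injEq] at this
          rw [this.1, this.2]
        rw [this, Finset.sum_const, nsmul_eq_mul]
        refine mul_le_mul_of_nonneg_right ?_ (mul_nonneg (hw0 _) (hw0 _))
        apply hcell _ (Finset.filter_subset _ _)
        · intro x hx y hy
          have h1 := (Finset.mem_filter.1 hx).2
          have h2 := (Finset.mem_filter.1 hy).2
          rw [Prod.mk.injEq] at h1 h2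
          have := hfl _ _ _ h1.1 h2.1
          convert this using 2; ring
        · intro x hx y hy
          have h1 := (Finset.mem_filter.1 hx).2
          have h2 := (Finset.mem_filter.1 hy).2
          rw [Prod.mk.injEq] at h1 h2
          have := hfl _ _ _ h1.2 h2.2
          convert this using 2; ring
    _ = B * ((∑ k ∈ E.image κ₁, w k) * (∑ k ∈ E.image κ₂, w k)) := by
        rw [← Finset.mul_sum, Finset.sum_mul_sum, Finset.sum_product]
    _ ≤ B * ((∑' k, w k) * (∑' k, w k)) := by
        have hs := summable_w
        have h1 := hs.sum_le_tsum (E.image κ₁) (fun k _ => hw0 k)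
        have h2 := hs.sum_le_tsum (E.image κ₂) (fun k _ => hw0 k)
        have h0 : 0 ≤ ∑' k, w k := tsum_nonneg hw0
        refine mul_le_mul_of_nonneg_left ?_ hB
        exact mul_le_mul h1 h2 (Finset.sum_nonneg fun k _ => hw0 k) h0
    _ = _ := by rw [sq]

lemma schur {α : Type*} (E : Finset α) (v : α → ℝ) (K : α → α → ℝ) (R : ℝ)
    (hK : ∀ m n, 0 ≤ K m n) (hsym : ∀ m n, K m n = K n m) (hR : ∀ m, ∑ n ∈ E, K m n ≤ R) :
    ∑ m ∈ E, ∑ n ∈ E, v m * v n * K m n ≤ R * ∑ m ∈ E, v m ^ 2 := by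
  have h1 : ∑ m ∈ E, ∑ n ∈ E, v m * v n * K m n ≤
      ∑ m ∈ E, ∑ n ∈ E, (v m ^ 2 * K m n / 2 + v n ^ 2 * K n m / 2) := by
    apply Finset.sum_le_sum; intro m _
    apply Finset.sum_le_sum; intro n _
    rw [hsym n m]
    have := hK m n
    nlinarith [mul_nonneg this (sq_nonneg (v m - v n))]
  refine h1.trans ?_
  have h2 : ∑ m ∈ E, ∑ n ∈ E, (v m ^ 2 * K m n / 2 + v n ^ 2 * K n m / 2) =
      ∑ m ∈ E, ∑ n ∈ E, v m ^ 2 * K m n := by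
    simp_rw [Finset.sum_add_distrib]
    rw [Finset.sum_comm (f := fun m n => v n ^ 2 * K n m / 2), ← Finset.sum_add_distrib]
    apply Finset.sum_congr rfl; intro m _
    rw [← Finset.sum_add_distrib]
    apply Finset.sum_congr rfl; intro n _
    ring
  rw [h2, Finset.mul_sum]
  apply Finset.sum_le_sum; intro m _
  rw [← Finset.mul_sum, mul_comm R]
  exact mul_le_mul_of_nonneg_left (hR m) (sq_nonneg _)

theorem stmt7 (ε : ℝ) (hε : 0 < ε) :
    ∃ C : ℝ, 0 < C ∧
      ∀ (lam : ℝ), 1 ≤ lam →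
        ∀ (a₁ a₂ : ℝ), |a₁| ≤ 1 → |a₂| ≤ 1 →
          ∀ (E : Finset (Fin 3 → ℤ)),
            (∀ n : Fin 3 → ℤ, n ∈ E ↔ (∑ i, ((n i : ℝ)) ^ 2) = lam ^ 2) →
              ∀ (c : (Fin 3 → ℤ) → ℂ) (x₀ : Fin 3 → ℝ),
                Real.sqrt (1 + a₁ ^ 2 + a₂ ^ 2) *
                  (∫ t in Set.univ.pi (fun _ : Fin 2 => Set.Icc (-1 : ℝ) 1),
                    ‖∑ n ∈ E, c n *
                      Complex.exp (Complex.I * (dotIR n (fun i =>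
                        x₀ i + t 0 * (![(1 : ℝ), 0, a₁] i) + t 1 * (![(0 : ℝ), 1, a₂] i)) : ℂ))‖ ^ 2)
                  ≤ C * lam ^ ((1 : ℝ) / 6 + ε) * ∑ n ∈ E, ‖c n‖ ^ 2 := by
  obtain ⟨C, hC, hcell⟩ := cell_count ε hε
  set T : ℝ := ∑' k : ℤ, 12 / (1 + (k : ℝ) ^ 2) with hT
  refine ⟨2 * (Real.exp 2 * Real.pi * (C * T ^ 2)) + 1, by positivity, ?_⟩
  intro lam hlam a₁ a₂ ha₁ ha₂ E hE c x₀
  have hl0 : 0 < lam := by linarith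
  set θ₁ : (Fin 3 → ℤ) → ℝ := fun n => n 0 + a₁ * n 2 with hθ₁
  set θ₂ : (Fin 3 → ℤ) → ℝ := fun n => n 1 + a₂ * n 2 with hθ₂
  set c' : (Fin 3 → ℤ) → ℂ := fun n => c n * Complex.exp ((dotIR n x₀ : ℝ) * Complex.I) with hc'
  have hnorm : ∀ n, ‖c' n‖ = ‖c n‖ := by
    intro n
    simp only [hc']
    rw [norm_mul, Complex.norm_exp_ofReal_mul_I, mul_one]
  have hfun : ∀ t : Fin 2 → ℝ, ∑ n ∈ E, c n *
      Complex.exp (Complex.I * (dotIR n (fun i =>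
        x₀ i + t 0 * (![(1 : ℝ), 0, a₁] i) + t 1 * (![(0 : ℝ), 1, a₂] i)) : ℂ)) =
      ∑ n ∈ E, c' n * Complex.exp (Complex.I * (θ₁ n * t 0 + θ₂ n * t 1)) := by
    intro t
    apply Finset.sum_congr rfl; intro n _
    simp only [hc']
    rw [mul_assoc, ← Complex.exp_add]
    congr 2
    simp only [dotIR, Fin.sum_univ_three, hθ₁, hθ₂]
    simp
    ring
  simp_rw [hfun]
  have hsq : Real.sqrt (1 + a₁ ^ 2 + a₂ ^ 2) ≤ 2 := by
    rw [Real.sqrt_le_left (by norm_num)]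
    have h1 := (sq_le_one_iff_abs_le_one a₁).2 ha₁
    have h2 := (sq_le_one_iff_abs_le_one a₂).2 ha₂
    linarith
  have hrow := schur_row E θ₁ θ₂ (C * lam ^ ((1 : ℝ) / 6 + ε)) (by positivity) (by
    intro S hS h1 h2
    apply hcell S lam a₁ a₂ hlam ha₁ ha₂
    · intro x hx
      have := (hE x).1 (hS hx)
      rwa [Fin.sum_univ_three] at this
    · intro x hx y hy
      have := h1 x hx y hy
      simp only [hθ₁] at this
      convert this using 2; ring
    · intro x hx y hy
      have := h2 x hx y hy
      simp only [hθ₂] at this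
      convert this using 2; ring)
  have hsch := schur E (fun n => ‖c' n‖) (fun m n =>
    Real.exp (-((θ₁ m - θ₁ n) ^ 2 + (θ₂ m - θ₂ n) ^ 2) / 4)) _ (fun m n => (Real.exp_pos _).le)
    (fun m n => by congr 1; ring) hrow
  have hg := gauss_bound E c' θ₁ θ₂
  simp only [hnorm] at hsch hg
  have hpos : 0 ≤ lam ^ ((1 : ℝ) / 6 + ε) * ∑ n ∈ E, ‖c n‖ ^ 2 := by positivity
  calc _ ≤ 2 * (Real.exp 2 * Real.pi * (C * lam ^ ((1 : ℝ) / 6 + ε) * T ^ 2 * ∑ n ∈ E, ‖c n‖ ^ 2)) := by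
        apply mul_le_mul hsq _ (by positivity) (by norm_num)
        refine hg.trans ?_
        gcongr
    _ = 2 * (Real.exp 2 * Real.pi * (C * T ^ 2)) * (lam ^ ((1 : ℝ) / 6 + ε) * ∑ n ∈ E, ‖c n‖ ^ 2) := by ring
    _ ≤ (2 * (Real.exp 2 * Real.pi * (C * T ^ 2)) + 1) * (lam ^ ((1 : ℝ) / 6 + ε) * ∑ n ∈ E, ‖c n‖ ^ 2) := by
        gcongr; linarith
    _ = _ := by ring
end

section
/- Let d ≥ 2 and 1 ≤ k ≤ d−1. There exist constants c, C > 0 depending only on d and k such that for every λ ≥ 1 with {m ∈ ℤ^{d−k+1} : |m| = λ} ≠ ∅, there exist real numbers a₂,…,a_{d−k+1} with |a_j| ≤ 1 and complex coefficients (c_n)_{n∈E} with Σ_{n∈E} |c_n|² = 1 (E = {n ∈ ℤ^d : |n| = λ}), such that, with Σ the totally geodesic k-dimensional submanifold parametrized by x(t₁,…,t_k) = (t₁, a₂t₁, …, a_{d−k+1}t₁, t₂, …, t_k) for t ∈ [−1,1]^k and surface measure dσ = √(1+a₂²+⋯+a_{d−k+1}²) dt, one has c · N_{d−k,λ} ≤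 ∫_{[−1,1]^k} |Σ_{n∈E} c_n e^{i n·x(t)}|² dσ ≤ C · N_{d−k,λ}. That is, ‖e_λ‖_{L²(Σ)} ≈ √(N_{d−k,λ}) ‖e_λ‖_{L²(T^d)} for some totally geodesic submanifold Σ of dimension k and some eigenfunction e_λ. -/
open MeasureTheory

/-- The number of lattice points of `ℤ^(k+1)` on the sphere of radius `lam`
that lie in the `lam^(1/2)`-cap centered at `ζ`. -/
noncomputable def capCount (k : ℕ) (lam : ℝ) (ζ : Fin (k + 1) → ℝ) : ℕ :=
  Set.ncard {n : Fin (k + 1) → ℤ |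
    (∑ i, ((n i : ℝ)) ^ 2) = lam ^ 2 ∧ (∑ i, ((n i : ℝ) - ζ i) ^ 2) ≤ lam}

/-- `N_{k,lam}`: the maximal number of lattice points of `ℤ^(k+1)` in a
`lam^(1/2)`-cap of the sphere of radius `lam`. -/
noncomputable def Ncap (k : ℕ) (lam : ℝ) : ℕ :=
  sSup {N : ℕ | ∃ ζ : Fin (k + 1) → ℝ, (∑ i, (ζ i) ^ 2) = lam ^ 2 ∧ N = capCount k lam ζ}

lemma capCount_perm (m : ℕ) (lam : ℝ) (ζ : Fin (m + 1) → ℝ) (σ : Equiv.Perm (Fin (m + 1))) :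
    capCount m lam (fun i => ζ (σ i)) = capCount m lam ζ := by
  unfold capCount
  symm
  refine Set.ncard_congr (fun n _ => fun i => n (σ i)) ?_ ?_ ?_
  · rintro n ⟨h1, h2⟩
    refine ⟨?_, ?_⟩
    · rw [← h1]; exact Equiv.sum_comp σ (fun i => ((n i : ℝ)) ^ 2)
    · rw [Equiv.sum_comp σ (fun i => ((n i : ℝ) - ζ i) ^ 2)]; exact h2
  · intro n n' _ _ h
    funext i
    have := congrFun h (σ.symm i)
    simpa using this
  · rintro n ⟨h1, h2⟩
    refine ⟨fun i => n (σ.symm i), ⟨?_, ?_⟩, ?_⟩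
    · rw [← h1]; exact Equiv.sum_comp σ.symm (fun i => ((n i : ℝ)) ^ 2)
    · rw [← Equiv.sum_comp σ (fun i => ((n (σ.symm i) : ℝ) - ζ i) ^ 2)]; simpa using h2
    · funext i; simp

lemma exists_cap (m : ℕ) (lam : ℝ) (hl : 1 ≤ lam)
    (hne : {n : Fin (m + 1) → ℤ | (∑ i, ((n i : ℝ)) ^ 2) = lam ^ 2}.Nonempty)
    (hfin : {n : Fin (m + 1) → ℤ | (∑ i, ((n i : ℝ)) ^ 2) = lam ^ 2}.Finite) :
    0 < Ncap m lam ∧ ∃ ζ : Fin (m + 1) → ℝ, (∑ i, (ζ i) ^ 2) = lam ^ 2 ∧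
      capCount m lam ζ = Ncap m lam ∧ ∀ i, |ζ i| ≤ |ζ 0| := by
  have hbdd : BddAbove {N : ℕ | ∃ ζ : Fin (m + 1) → ℝ,
      (∑ i, (ζ i) ^ 2) = lam ^ 2 ∧ N = capCount m lam ζ} := by
    refine ⟨Set.ncard {n : Fin (m + 1) → ℤ | (∑ i, ((n i : ℝ)) ^ 2) = lam ^ 2}, ?_⟩
    rintro N ⟨ζ, _, rfl⟩
    exact Set.ncard_le_ncard (fun n hn => hn.1) hfin
  obtain ⟨n, hn⟩ := hne
  have hn' : (∑ i, ((n i : ℝ)) ^ 2) = lam ^ 2 := hn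
  have hmem : capCount m lam (fun i => (n i : ℝ)) ∈ {N : ℕ | ∃ ζ : Fin (m + 1) → ℝ,
      (∑ i, (ζ i) ^ 2) = lam ^ 2 ∧ N = capCount m lam ζ} := ⟨_, hn', rfl⟩
  constructor
  · refine lt_of_lt_of_le ?_ (le_csSup hbdd hmem)
    unfold capCount
    rw [Set.ncard_pos (hfin.subset fun n hn => hn.1)]
    exact ⟨n, hn', by simp; linarith⟩
  · obtain ⟨ζ, h1, h2⟩ := Nat.sSup_mem ⟨_, hmem⟩ hbdd
    obtain ⟨j, hj⟩ := Finite.exists_max (fun i => |ζ i|)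
    refine ⟨fun i => ζ (Equiv.swap 0 j i), ?_, ?_, ?_⟩
    · rw [← h1]; exact Equiv.sum_comp (Equiv.swap 0 j) (fun i => (ζ i) ^ 2)
    · rw [capCount_perm]; exact h2.symm
    · intro i; simpa using hj _

lemma trig_upper {ι : Type*} (F : Finset ι) (θ : ι → ℝ) (t : ℝ) (N : ℕ) (hN : 0 < N)
    (hF : F.card = N) :
    ‖∑ n ∈ F, ((1 / Real.sqrt N : ℝ) : ℂ) * Complex.exp (Complex.I * ((θ n * t : ℝ) : ℂ))‖ ^ 2
      ≤ N := by
  have hN' : (0 : ℝ) < N := by exact_mod_cast hN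
  have h : ‖∑ n ∈ F, ((1 / Real.sqrt N : ℝ) : ℂ) *
      Complex.exp (Complex.I * ((θ n * t : ℝ) : ℂ))‖ ≤ Real.sqrt N := by
    refine (norm_sum_le _ _).trans ?_
    have : ∀ n ∈ F, ‖((1 / Real.sqrt N : ℝ) : ℂ) *
      Complex.exp (Complex.I * ((θ n * t : ℝ) : ℂ))‖ = 1 / Real.sqrt N := by
      intro n _
      rw [norm_mul, mul_comm Complex.I, Complex.norm_exp_ofReal_mul_I, Complex.norm_real,
        Real.norm_of_nonneg (by positivity), mul_one]
    rw [Finset.sum_congr rfl this, Finset.sum_const, hF, nsmul_eq_mul, mul_one_div,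
      Real.div_sqrt]
  calc _ ≤ Real.sqrt N ^ 2 := by gcongr
    _ = N := Real.sq_sqrt hN'.le

lemma trig_lower {ι : Type*} (F : Finset ι) (θ : ι → ℝ) (θ0 D t : ℝ) (N : ℕ) (hN : 0 < N)
    (hF : F.card = N) (hθ : ∀ n ∈ F, |θ n - θ0| ≤ D) (ht : D * |t| ≤ 1) :
    (N : ℝ) / 4 ≤
    ‖∑ n ∈ F, ((1 / Real.sqrt N : ℝ) : ℂ) * Complex.exp (Complex.I * ((θ n * t : ℝ) : ℂ))‖ ^ 2
       := by
  have hN' : (0 : ℝ) < N := by exact_mod_cast hN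
  have h : Real.sqrt N / 2 ≤ ‖∑ n ∈ F, ((1 / Real.sqrt N : ℝ) : ℂ) *
      Complex.exp (Complex.I * ((θ n * t : ℝ) : ℂ))‖ := by
    have e1 : ∑ n ∈ F, ((1 / Real.sqrt N : ℝ) : ℂ) *
      Complex.exp (Complex.I * ((θ n * t : ℝ) : ℂ)) =
      Complex.exp (((θ0 * t : ℝ) : ℂ) * Complex.I) * ∑ n ∈ F, ((1 / Real.sqrt N : ℝ) : ℂ) *
      Complex.exp ((((θ n - θ0) * t : ℝ) : ℂ) * Complex.I) := by
      rw [Finset.mul_sum]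
      refine Finset.sum_congr rfl fun n _ => ?_
      rw [mul_left_comm, ← Complex.exp_add]
      congr 2
      push_cast; ring
    rw [e1, norm_mul, Complex.norm_exp_ofReal_mul_I, one_mul]
    refine le_trans ?_ (Complex.re_le_norm _)
    rw [Complex.re_sum]
    have : ∀ n ∈ F, 1 / Real.sqrt N * (1 / 2) ≤ (((1 / Real.sqrt N : ℝ) : ℂ) *
      Complex.exp ((((θ n - θ0) * t : ℝ) : ℂ) * Complex.I)).re := by
      intro n hn
      rw [Complex.re_ofReal_mul, Complex.exp_ofReal_mul_I_re]
      refine mul_le_mul_of_nonneg_left ?_ (by positivity)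
      have h1 : |(θ n - θ0) * t| ≤ 1 := by
        rw [abs_mul]
        exact (mul_le_mul_of_nonneg_right (hθ n hn) (abs_nonneg _)).trans ht
      have h2 := Real.one_sub_sq_div_two_le_cos (x := (θ n - θ0) * t)
      have h3 := (sq_le_one_iff_abs_le_one _).2 h1
      linarith
    refine le_trans ?_ (Finset.sum_le_sum this)
    rw [Finset.sum_const, hF, nsmul_eq_mul, ← mul_assoc, mul_one_div, mul_one_div, Real.div_sqrt]
  calc (N : ℝ) / 4 = (Real.sqrt N / 2) ^ 2 := by rw [div_pow, Real.sq_sqrt hN'.le]; norm_num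
    _ ≤ _ := by gcongr

lemma box_bounds (k : ℕ) (f : (Fin k → ℝ) → ℝ) (hf : Continuous f) (N δ : ℝ) (hδ0 : 0 < δ)
    (hδ1 : δ ≤ 1) (h0 : ∀ t, 0 ≤ f t) (hu : ∀ t, f t ≤ N)
    (hlow : ∀ t, (∀ i, |t i| ≤ δ) → N / 4 ≤ f t) :
    (2 * δ) ^ k * (N / 4) ≤ ∫ t in Set.univ.pi (fun _ : Fin k => Set.Icc (-1 : ℝ) 1), f t ∧
    ∫ t in Set.univ.pi (fun _ : Fin k => Set.Icc (-1 : ℝ) 1), f t ≤ 2 ^ k * N := by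
  have hc : ∀ r : ℝ, IsCompact (Set.univ.pi (fun _ : Fin k => Set.Icc (-r) r)) := fun r =>
    isCompact_univ_pi fun _ => isCompact_Icc
  have hv : ∀ r : ℝ, 0 < r →
      volume.real (Set.univ.pi (fun _ : Fin k => Set.Icc (-r) r)) = (2 * r) ^ k := by
    intro r hr
    rw [measureReal_def, volume_pi_pi]
    simp [Real.volume_Icc, ENNReal.toReal_ofReal, hr.le, ← two_mul]
  have hi : ∀ r : ℝ, IntegrableOn f (Set.univ.pi (fun _ : Fin k => Set.Icc (-r) r)) := fun r =>
    hf.continuousOn.integrableOn_compact (hc r)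
  have hm : ∀ r : ℝ, MeasurableSet (Set.univ.pi (fun _ : Fin k => Set.Icc (-r) r)) := fun r =>
    (hc r).measurableSet
  constructor
  · calc (2 * δ) ^ k * (N / 4) =
        ∫ t in Set.univ.pi (fun _ : Fin k => Set.Icc (-δ) δ), (N / 4 : ℝ) := by
          rw [setIntegral_const, hv δ hδ0, smul_eq_mul]
      _ ≤ ∫ t in Set.univ.pi (fun _ : Fin k => Set.Icc (-δ) δ), f t := by
          refine setIntegral_mono_on (integrableOn_const (hc δ).measure_lt_top.ne) (hi δ) (hm δ) ?_
          intro t ht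
          exact hlow t fun i => abs_le.2 (ht i (Set.mem_univ i))
      _ ≤ _ := by
          refine setIntegral_mono_set (hi 1) (Filter.Eventually.of_forall h0) ?_
          refine (Set.pi_mono fun i _ => Set.Icc_subset_Icc (by linarith) hδ1).eventuallyLE
  · calc _ ≤ ∫ t in Set.univ.pi (fun _ : Fin k => Set.Icc (-1 : ℝ) 1), N :=
          setIntegral_mono_on (hi 1) (integrableOn_const (hc 1).measure_lt_top.ne) (hm 1)
            fun t _ => hu t
      _ = _ := by rw [setIntegral_const, hv 1 one_pos, smul_eq_mul, mul_one]

lemma trig_box {ι : Type*} (k : ℕ) (i0 : Fin k) (S : Finset ι) (θ : ι → ℝ) (θ0 D : ℝ)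
    (hD : 1 ≤ D) (N : ℕ) (hN : 0 < N) (hS : S.card = N) (hθ : ∀ n ∈ S, |θ n - θ0| ≤ D) :
    (2 * (1 / D)) ^ k * ((N : ℝ) / 4) ≤
      ∫ t in Set.univ.pi (fun _ : Fin k => Set.Icc (-1 : ℝ) 1),
        ‖∑ n ∈ S, ((1 / Real.sqrt N : ℝ) : ℂ) *
          Complex.exp (Complex.I * ((θ n * t i0 : ℝ) : ℂ))‖ ^ 2 ∧
    ∫ t in Set.univ.pi (fun _ : Fin k => Set.Icc (-1 : ℝ) 1),
        ‖∑ n ∈ S, ((1 / Real.sqrt N : ℝ) : ℂ) *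
          Complex.exp (Complex.I * ((θ n * t i0 : ℝ) : ℂ))‖ ^ 2 ≤ 2 ^ k * N := by
  have hDp : 0 < D := by linarith
  refine box_bounds k _ ?_ N (1 / D) (by positivity) ((div_le_one hDp).2 hD)
    (fun t => by positivity) (fun t => trig_upper S θ _ _ hN hS) ?_
  · fun_prop
  · intro t ht
    refine trig_lower S θ θ0 D _ _ hN hS hθ ?_
    have := ht i0
    rw [le_div_iff₀ hDp] at this
    linarith

/-- extension by zero -/
def extz {R : Type*} [Zero R] (d p : ℕ) (n : Fin p → R) : Fin d → R :=
  fun i => if h : i.val < p then n ⟨i.val, h⟩ else 0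

lemma extz_sum {R : Type*} [Zero R] (d p : ℕ) (hp : p ≤ d) (n : Fin p → R) (g : Fin d → R → ℝ)
    (hg : ∀ i, g i 0 = 0) :
    ∑ i, g i (extz d p n i) = ∑ j : Fin p, g (Fin.castLE hp j) (n j) := by
  symm
  refine Finset.sum_of_injOn (Fin.castLE hp) (Fin.castLE_injective hp).injOn (by simp) ?_ ?_
  · intro i _ hi
    have : ¬ i.val < p := by
      intro h
      exact hi ⟨⟨i.val, h⟩, by simp, by ext; simp⟩
    simp [extz, this, hg]
  · intro j _
    simp [extz]

lemma extz_inj {R : Type*} [Zero R] (d p : ℕ) (hp : p ≤ d) :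
    Function.Injective (extz (R := R) d p) := by
  intro n n' h
  funext j
  have := congrFun h (Fin.castLE hp j)
  simpa [extz] using this

set_option maxHeartbeats 1600000 in
theorem stmt8 (d k : ℕ) (hd : 2 ≤ d) (hk1 : 1 ≤ k) (hk2 : k ≤ d - 1) :
    ∃ c C : ℝ, 0 < c ∧ 0 < C ∧
      ∀ (lam : ℝ), 1 ≤ lam →
        {m : Fin (d - k + 1) → ℤ | (∑ i, ((m i : ℝ)) ^ 2) = lam ^ 2}.Nonempty →
        ∀ (E : Finset (Fin d → ℤ)),
          (∀ n : Fin d → ℤ, n ∈ E ↔ (∑ i, ((n i : ℝ)) ^ 2) = lam ^ 2) →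
            ∃ (a : Fin d → ℝ) (co : (Fin d → ℤ) → ℂ),
              (∀ i : Fin d, i.val = 0 → a i = 1) ∧
              (∀ i : Fin d, |a i| ≤ 1) ∧
              (∀ i : Fin d, d - k + 1 ≤ i.val → a i = 0) ∧
              (∑ n ∈ E, ‖co n‖ ^ 2) = 1 ∧
              c * (Ncap (d - k) lam) ≤
                Real.sqrt (∑ i, (a i) ^ 2) *
                  (∫ t in Set.univ.pi (fun _ : Fin k => Set.Icc (-1 : ℝ) 1),
                    ‖∑ n ∈ E, co n *
                      Complex.exp (Complex.I * (dotIR n (fun i =>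
                        if h : i.val < d - k + 1 then a i * t ⟨0, by omega⟩
                        else t ⟨i.val - (d - k), by have hi := i.isLt; omega⟩) : ℂ))‖ ^ 2) ∧
              Real.sqrt (∑ i, (a i) ^ 2) *
                  (∫ t in Set.univ.pi (fun _ : Fin k => Set.Icc (-1 : ℝ) 1),
                    ‖∑ n ∈ E, co n *
                      Complex.exp (Complex.I * (dotIR n (fun i =>
                        if h : i.val < d - k + 1 then a i * t ⟨0, by omega⟩
                        else t ⟨i.val - (d - k), by have hi := i.isLt; omega⟩) : ℂ))‖ ^ 2)
                ≤ C * (Ncap (d - k) lam) := by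
  have hp : d - k + 1 ≤ d := by omega
  have hdpos : (0 : ℝ) < d := by exact_mod_cast (by omega : 0 < d)
  have hd1 : (1 : ℝ) ≤ d := by exact_mod_cast (by omega : 1 ≤ d)
  refine ⟨(2 * (1 / (d : ℝ))) ^ k / 4, d * 2 ^ k, by positivity, by positivity, ?_⟩
  intro lam hl hne E hE
  have hlam : 0 < lam := by linarith
  have hsq : ∀ n : Fin (d - k + 1) → ℤ,
      ∑ i, ((extz d (d - k + 1) n i : ℤ) : ℝ) ^ 2 = ∑ j, (n j : ℝ) ^ 2 := fun n =>
    extz_sum d (d - k + 1) hp n (fun _ z => (z : ℝ) ^ 2) (by simp)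
  have hfin : {n : Fin (d - k + 1) → ℤ | (∑ i, ((n i : ℝ)) ^ 2) = lam ^ 2}.Finite := by
    refine Set.Finite.of_finite_image (f := extz d (d - k + 1)) ?_ (extz_inj _ _ hp).injOn
    refine E.finite_toSet.subset ?_
    rintro _ ⟨n, hn, rfl⟩
    rw [Finset.mem_coe, hE, hsq]
    exact hn
  obtain ⟨hN, ζ, hζ1, hζ2, hζ3⟩ := exists_cap (d - k) lam hl hne hfin
  have hSfin : {n : Fin (d - k + 1) → ℤ |
      (∑ i, ((n i : ℝ)) ^ 2) = lam ^ 2 ∧ (∑ i, ((n i : ℝ) - ζ i) ^ 2) ≤ lam}.Finite :=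
    hfin.subset fun n hn => hn.1
  classical
  let S := hSfin.toFinset
  have hScard : S.card = Ncap (d - k) lam := by
    rw [← hζ2]; unfold capCount; exact (Set.ncard_eq_toFinset_card _ hSfin).symm
  have hSmem : ∀ n, n ∈ S ↔ ((∑ i, ((n i : ℝ)) ^ 2) = lam ^ 2 ∧
      (∑ i, ((n i : ℝ) - ζ i) ^ 2) ≤ lam) := fun n => hSfin.mem_toFinset
  let F := S.image (extz d (d - k + 1))
  have hFE : F ⊆ E := by
    intro x hx
    obtain ⟨n, hn, rfl⟩ := Finset.mem_image.1 hx
    rw [hE, hsq]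
    exact ((hSmem n).1 hn).1
  -- the size of the leading coordinate
  have hz0 : lam ≤ d * |ζ 0| := by
    have h1 : lam ^ 2 ≤ d * (ζ 0) ^ 2 := by
      rw [← hζ1]
      calc ∑ i, ζ i ^ 2 ≤ ∑ i : Fin (d - k + 1), ζ 0 ^ 2 :=
            Finset.sum_le_sum fun i _ => sq_le_sq.2 (hζ3 i)
        _ = ((d - k + 1 : ℕ) : ℝ) * ζ 0 ^ 2 := by simp
        _ ≤ _ := by
            have : ((d - k + 1 : ℕ) : ℝ) ≤ d := by exact_mod_cast hp
            exact mul_le_mul_of_nonneg_right this (sq_nonneg _)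
    have h2 : lam ^ 2 ≤ (d * |ζ 0|) ^ 2 := by
      rw [mul_pow, sq_abs]
      nlinarith [sq_nonneg (ζ 0), mul_nonneg (sub_nonneg.2 hd1) (mul_nonneg hdpos.le (sq_nonneg (ζ 0)))]
    exact le_of_sq_le_sq h2 (by positivity)
  have hz0pos : 0 < |ζ 0| := by
    by_contra h
    have : |ζ 0| = 0 := le_antisymm (not_lt.1 h) (abs_nonneg _)
    rw [this] at hz0; linarith
  have hz0ne : ζ 0 ≠ 0 := abs_pos.1 hz0pos
  let a : Fin d → ℝ := extz d (d - k + 1) (fun j => ζ j / ζ 0)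
  let co : (Fin d → ℤ) → ℂ := fun n =>
    if n ∈ F then ((1 / Real.sqrt (Ncap (d - k) lam) : ℝ) : ℂ) else 0
  have ha0 : ∀ i : Fin d, i.val = 0 → a i = 1 := by
    intro i hi
    have : (⟨i.val, by omega⟩ : Fin (d - k + 1)) = 0 := by ext; simpa using hi
    simp only [a, extz]
    rw [dif_pos (by omega), this, div_self hz0ne]
  have ha1 : ∀ i : Fin d, |a i| ≤ 1 := by
    intro i
    simp only [a, extz]
    split_ifs with h
    · rw [abs_div, div_le_one hz0pos]; exact hζ3 _
    · simp
  have ha2 : ∀ i : Fin d, d - k + 1 ≤ i.val → a i = 0 := by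
    intro i hi
    simp only [a, extz]
    rw [dif_neg (by omega)]
  have hNr : (0 : ℝ) < Ncap (d - k) lam := by exact_mod_cast hN
  have hco : ∑ n ∈ E, ‖co n‖ ^ 2 = 1 := by
    have h1 : ∀ n ∈ E, ‖co n‖ ^ 2 = if n ∈ F then 1 / (Ncap (d - k) lam : ℝ) else 0 := by
      intro n _
      simp only [co]
      split_ifs
      · rw [Complex.norm_real, Real.norm_eq_abs, sq_abs, div_pow, Real.sq_sqrt hNr.le, one_pow]
      · simp
    rw [Finset.sum_congr rfl h1, Finset.sum_ite_mem, Finset.inter_eq_right.2 hFE,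
      Finset.sum_const, Finset.card_image_of_injective _ (extz_inj _ _ hp), hScard, nsmul_eq_mul,
      mul_one_div, div_self hNr.ne']
  have hs1 : 1 ≤ Real.sqrt (∑ i, (a i) ^ 2) := by
    rw [Real.one_le_sqrt]
    have := Finset.single_le_sum (f := fun i => (a i) ^ 2) (fun i _ => sq_nonneg _)
      (Finset.mem_univ (⟨0, by omega⟩ : Fin d))
    simpa [ha0 ⟨0, by omega⟩ rfl] using this
  have hs2 : Real.sqrt (∑ i, (a i) ^ 2) ≤ d := by
    rw [Real.sqrt_le_left hdpos.le]
    calc ∑ i, a i ^ 2 ≤ ∑ i : Fin d, (1 : ℝ) :=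
          Finset.sum_le_sum fun i _ => (sq_le_one_iff_abs_le_one _).2 (ha1 i)
      _ = d := by simp
      _ ≤ (d : ℝ) ^ 2 := by nlinarith
  let θ : (Fin (d - k + 1) → ℤ) → ℝ := fun n => ∑ j, (n j : ℝ) * (ζ j / ζ 0)
  have hθ : ∀ n ∈ S, |θ n - lam ^ 2 / ζ 0| ≤ d := by
    intro n hn
    obtain ⟨h1, h2⟩ := (hSmem n).1 hn
    have h3 : θ n - lam ^ 2 / ζ 0 = -((∑ i, ((n i : ℝ) - ζ i) ^ 2) / 2) / ζ 0 := by
      have h4 : ∑ i, ((n i : ℝ) - ζ i) ^ 2 = lam ^ 2 + lam ^ 2 - 2 * ∑ i, (n i : ℝ) * ζ i := by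
        nth_rewrite 1 [← h1]
        rw [← hζ1, Finset.mul_sum, ← Finset.sum_add_distrib, ← Finset.sum_sub_distrib]
        exact Finset.sum_congr rfl fun i _ => by ring
      have h5 : θ n = (∑ i, (n i : ℝ) * ζ i) / ζ 0 := by
        simp only [θ]
        rw [Finset.sum_div]
        exact Finset.sum_congr rfl fun i _ => by ring
      rw [h4, h5]; ring
    have h6 : 0 ≤ ∑ i, ((n i : ℝ) - ζ i) ^ 2 := Finset.sum_nonneg fun i _ => sq_nonneg _
    rw [h3, abs_div, abs_neg, abs_of_nonneg (by positivity), div_le_iff₀ hz0pos]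
    linarith
  have key : ∀ t : Fin k → ℝ, (∑ n ∈ E, co n *
      Complex.exp (Complex.I * (dotIR n (fun i =>
        if h : i.val < d - k + 1 then a i * t ⟨0, by omega⟩
        else t ⟨i.val - (d - k), by have hi := i.isLt; omega⟩) : ℂ))) =
      ∑ n ∈ S, ((1 / Real.sqrt (Ncap (d - k) lam) : ℝ) : ℂ) *
        Complex.exp (Complex.I * ((θ n * t ⟨0, by omega⟩ : ℝ) : ℂ)) := by
    intro t
    simp only [co, ite_mul, zero_mul]
    rw [Finset.sum_ite_mem, Finset.inter_eq_right.2 hFE,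
      Finset.sum_image (extz_inj _ _ hp).injOn]
    refine Finset.sum_congr rfl fun n _ => ?_
    congr 4
    unfold dotIR
    rw [extz_sum d (d - k + 1) hp n (fun i z => (z : ℝ) * (if h : i.val < d - k + 1 then a i * t ⟨0, by omega⟩
        else t ⟨i.val - (d - k), by have hi := i.isLt; omega⟩)) (by simp)]
    simp only [θ]
    rw [Finset.sum_mul]
    refine Finset.sum_congr rfl fun j _ => ?_
    have hj : j.val ≤ d - k := by have := j.isLt; omega
    simp [a, extz, mul_assoc, hj]
  obtain ⟨hb1, hb2⟩ := trig_box k ⟨0, by omega⟩ S θ (lam ^ 2 / ζ 0) d hd1 _ hN hScard hθ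
  refine ⟨a, co, ha0, ha1, ha2, hco, ?_, ?_⟩
  · simp only [key]
    refine le_trans ?_ (mul_le_mul hs1 hb1 (by positivity) (Real.sqrt_nonneg _))
    apply le_of_eq; ring
  · simp only [key]
    refine (mul_le_mul hs2 hb2 ?_ hdpos.le).trans (le_of_eq (by ring))
    exact le_trans (by positivity) hb1
end

section
/- Let d ≥ 2 and let a_j = p_j/q_j for j = 1,…,d−1 be rational numbers with gcd(p_j,q_j) = 1, q_j ≥ 1 and |p_j| ≤ q_j. Let Σ be the rational totally geodesic hypersurface of T^d parametrized by x(t) = x₀ + (t₁,…,t_{d−1}, a₁t₁+⋯+a_{d−1}t_{d−1}) for t ∈ [−1,1]^{d−1}, with surface measure dσ = √(1+a₁²+⋯+a_{d−1}²) dt. There exists a constant C = C(d), independent of λ and of the a_j, such that for every λ ≥ 1, every x₀ ∈ ℝ^d, and every choice of complex coefficients (c_n)_{n∈E} with E = {n ∈ ℤ^d : |n| = λ}, one has ∫_{[−1,1]^{d−1}} |Σ_{n∈E} c_n e^{i n·x(t)}|² dσ ≤ C · (q₁q₂⋯q_{d−1}) · Σ_{n∈E} |c_n|². In particular, for each fixed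 rational hyperplane Σ, ‖e_λ‖_{L²(Σ)} ≤ C_Σ ‖e_λ‖_{L²(T^d)} uniformly in λ, verifying the Bourgain–Rudnick conjecture for rational hyperplanes. -/
open MeasureTheory

lemma aux_int1 (q : ℤ) (hq : 1 ≤ q) (m : ℤ) :
    ∫ t in Set.Icc (-(Real.pi * q)) (Real.pi * q),
      Complex.exp (Complex.I * ((m : ℂ) / (q : ℂ) * (t : ℂ))) =
      if m = 0 then ((2 * Real.pi * q : ℝ) : ℂ) else 0 := by
  have hq0 : (0 : ℝ) < q := by exact_mod_cast (by omega : 0 < q)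
  have hpq : 0 < Real.pi * q := mul_pos Real.pi_pos hq0
  have hqc : (q : ℂ) ≠ 0 := by exact_mod_cast (by omega : q ≠ 0)
  rw [integral_Icc_eq_integral_Ioc, ← intervalIntegral.integral_of_le (by linarith)]
  split_ifs with h
  · subst h
    simp
    ring
  · have hm : (m : ℂ) ≠ 0 := by exact_mod_cast h
    have hc : Complex.I * ((m : ℂ) / (q : ℂ)) ≠ 0 :=
      mul_ne_zero Complex.I_ne_zero (div_ne_zero hm hqc)
    have := integral_exp_mul_complex (a := -(Real.pi * q)) (b := Real.pi * q) hc
    simp only [mul_assoc] at this ⊢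
    rw [this, div_eq_zero_iff]
    left
    rw [sub_eq_zero, Complex.exp_eq_exp_iff_exists_int]
    refine ⟨m, ?_⟩
    push_cast
    field_simp
    ring

lemma aux_int {k : ℕ} (q : Fin k → ℤ) (hq : ∀ j, 1 ≤ q j) (m : Fin k → ℤ) :
    ∫ t in Set.univ.pi (fun j : Fin k => Set.Icc (-(Real.pi * q j)) (Real.pi * q j)),
      Complex.exp (Complex.I * ∑ j, ((m j : ℂ) / (q j : ℂ) * (t j : ℂ))) =
      if m = 0 then ((∏ j, (2 * Real.pi * q j) : ℝ) : ℂ) else 0 := by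
  have h1 : ∀ t : Fin k → ℝ, Complex.exp (Complex.I * ∑ j, ((m j : ℂ) / (q j : ℂ) * (t j : ℂ))) =
      ∏ j, Complex.exp (Complex.I * ((m j : ℂ) / (q j : ℂ) * (t j : ℂ))) := by
    intro t
    rw [Finset.mul_sum, Complex.exp_sum]
  simp_rw [h1]
  rw [volume_pi, Measure.restrict_pi_pi]
  rw [integral_fintype_prod_eq_prod
    (fun j (x : ℝ) => Complex.exp (Complex.I * ((m j : ℂ) / (q j : ℂ) * (x : ℂ))))]
  simp_rw [fun j => aux_int1 (q j) (hq j) (m j)]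
  split_ifs with h
  · subst h
    simp
  · obtain ⟨j, hj⟩ : ∃ j, m j ≠ 0 := by
      by_contra hcon
      push Not at hcon
      exact h (funext hcon)
    exact Finset.prod_eq_zero (Finset.mem_univ j) (by simp [hj])

lemma aux_orth {k : ℕ} {ι : Type*} (q : Fin k → ℤ) (hq : ∀ j, 1 ≤ q j) (E : Finset ι)
    (b : ι → ℂ) (m : ι → Fin k → ℤ) :
    ((∫ t in Set.univ.pi (fun j : Fin k => Set.Icc (-(Real.pi * q j)) (Real.pi * q j)),
      ‖∑ n ∈ E, b n * Complex.exp (Complex.I * ∑ j, ((m n j : ℂ) / (q j : ℂ) * (t j : ℂ)))‖ ^ 2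
      : ℝ) : ℂ) =
    ∑ n ∈ E, ∑ n' ∈ E, b n * (starRingEnd ℂ) (b n') *
      (if m n = m n' then ((∏ j, (2 * Real.pi * q j) : ℝ) : ℂ) else 0) := by
  rw [← integral_complex_ofReal]
  have h1 : ∀ t : Fin k → ℝ,
      ((‖∑ n ∈ E, b n *
        Complex.exp (Complex.I * ∑ j, ((m n j : ℂ) / (q j : ℂ) * (t j : ℂ)))‖ ^ 2 : ℝ) : ℂ) =
      ∑ n ∈ E, ∑ n' ∈ E, b n * (starRingEnd ℂ) (b n') *
        Complex.exp (Complex.I * ∑ j, (((m n - m n') j : ℤ) : ℂ) / (q j : ℂ) * (t j : ℂ)) := by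
    intro t
    push_cast
    rw [← Complex.mul_conj', map_sum, Finset.sum_mul_sum]
    refine Finset.sum_congr rfl fun n _ => Finset.sum_congr rfl fun n' _ => ?_
    rw [map_mul, ← Complex.exp_conj]
    have : ∀ x y u v : ℂ, x * Complex.exp u * (y * Complex.exp v) = x * y * Complex.exp (u + v) := by
      intro x y u v
      rw [Complex.exp_add]; ring
    rw [this]
    congr 2
    simp only [map_mul, map_sum, Complex.conj_I, map_div₀, Complex.conj_ofReal, map_intCast,
      Pi.sub_apply, Int.cast_sub]
    rw [neg_mul, ← sub_eq_add_neg, ← mul_sub, ← Finset.sum_sub_distrib]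
    congr 1
    refine Finset.sum_congr rfl fun j _ => ?_
    ring
  simp_rw [h1]
  have hK : IsCompact (Set.univ.pi
      (fun j : Fin k => Set.Icc (-(Real.pi * q j)) (Real.pi * q j))) :=
    isCompact_univ_pi fun _ => isCompact_Icc
  have hint : ∀ n n', Integrable (fun t : Fin k → ℝ => b n * (starRingEnd ℂ) (b n') *
        Complex.exp (Complex.I * ∑ j, (((m n - m n') j : ℤ) : ℂ) / (q j : ℂ) * (t j : ℂ)))
      (volume.restrict (Set.univ.pi
      (fun j : Fin k => Set.Icc (-(Real.pi * q j)) (Real.pi * q j)))) := by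
    intro n n'
    refine ContinuousOn.integrableOn_compact hK (Continuous.continuousOn ?_)
    fun_prop
  rw [integral_finsetSum _ fun n _ => integrable_finsetSum _ fun n' _ => hint n n']
  refine Finset.sum_congr rfl fun n _ => ?_
  rw [integral_finsetSum _ fun n' _ => hint n n']
  refine Finset.sum_congr rfl fun n' _ => ?_
  rw [integral_const_mul, aux_int q hq]
  simp only [sub_eq_zero]

lemma aux_bound {k : ℕ} {ι : Type*} (q : Fin k → ℤ) (hq : ∀ j, 1 ≤ q j) (E : Finset ι)
    (b : ι → ℂ) (m : ι → Fin k → ℤ)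
    (hcard : ∀ n ∈ E, (E.filter (fun n' => m n = m n')).card ≤ 2) :
    ∫ t in Set.univ.pi (fun _ : Fin k => Set.Icc (-1 : ℝ) 1),
      ‖∑ n ∈ E, b n * Complex.exp (Complex.I * ∑ j, ((m n j : ℂ) / (q j : ℂ) * (t j : ℂ)))‖ ^ 2
      ≤ 2 * (∏ j, (2 * Real.pi * q j)) * ∑ n ∈ E, ‖b n‖ ^ 2 := by
  have hP : 0 ≤ ∏ j, (2 * Real.pi * (q j : ℝ)) := by
    refine Finset.prod_nonneg fun j _ => ?_
    have : (1 : ℝ) ≤ q j := by exact_mod_cast hq j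
    have := Real.pi_pos
    positivity
  have hK : IsCompact (Set.univ.pi
      (fun j : Fin k => Set.Icc (-(Real.pi * q j)) (Real.pi * q j))) :=
    isCompact_univ_pi fun _ => isCompact_Icc
  have hsub : Set.univ.pi (fun _ : Fin k => Set.Icc (-1 : ℝ) 1) ⊆ Set.univ.pi
      (fun j : Fin k => Set.Icc (-(Real.pi * q j)) (Real.pi * q j)) := by
    refine Set.pi_mono fun j _ => ?_
    have h1 : (1 : ℝ) ≤ q j := by exact_mod_cast hq j
    have h2 := Real.pi_gt_three
    have : 1 ≤ Real.pi * q j := by nlinarith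
    exact Set.Icc_subset_Icc (by linarith) this
  refine (setIntegral_mono_set (ContinuousOn.integrableOn_compact hK (Continuous.continuousOn
    (by fun_prop))) (Filter.Eventually.of_forall fun t => by positivity)
    hsub.eventuallyLE).trans ?_
  have h := congrArg (fun z : ℂ => ‖z‖) (aux_orth q hq E b m)
  simp only [Complex.norm_real, Real.norm_eq_abs] at h
  refine (le_abs_self _).trans (h.le.trans ?_)
  set P := ∏ j, (2 * Real.pi * (q j : ℝ)) with hPdef
  have hsym : ∑ n ∈ E, ∑ n' ∈ E, (if m n = m n' then ‖b n'‖ ^ 2 * P / 2 else 0) =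
      ∑ n ∈ E, ∑ n' ∈ E, (if m n = m n' then ‖b n‖ ^ 2 * P / 2 else 0) := by
    rw [Finset.sum_comm]
    refine Finset.sum_congr rfl fun n _ => Finset.sum_congr rfl fun n' _ => ?_
    simp only [eq_comm]
  calc _ ≤ ∑ n ∈ E, ∑ n' ∈ E, ((if m n = m n' then ‖b n‖ ^ 2 * P / 2 else 0) +
          (if m n = m n' then ‖b n'‖ ^ 2 * P / 2 else 0)) := by
        refine (norm_sum_le _ _).trans (Finset.sum_le_sum fun n _ => ?_)
        refine (norm_sum_le _ _).trans (Finset.sum_le_sum fun n' _ => ?_)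
        split_ifs
        · rw [norm_mul, norm_mul, RCLike.norm_conj, Complex.norm_real, Real.norm_eq_abs,
            abs_of_nonneg hP]
          nlinarith [mul_nonneg (sq_nonneg (‖b n‖ - ‖b n'‖)) hP]
        · simp
    _ = ∑ n ∈ E, ∑ n' ∈ E, (if m n = m n' then ‖b n‖ ^ 2 * P else 0) := by
        simp only [Finset.sum_add_distrib]
        rw [hsym, ← Finset.sum_add_distrib]
        refine Finset.sum_congr rfl fun n _ => ?_
        rw [← Finset.sum_add_distrib]
        refine Finset.sum_congr rfl fun n' _ => ?_
        split_ifs <;> ring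
    _ ≤ ∑ n ∈ E, 2 * (‖b n‖ ^ 2 * P) := by
        refine Finset.sum_le_sum fun n hn => ?_
        rw [← Finset.sum_filter, Finset.sum_const, nsmul_eq_mul]
        have : ((E.filter (fun n' => m n = m n')).card : ℝ) ≤ 2 := by exact_mod_cast hcard n hn
        have h0 : 0 ≤ ‖b n‖ ^ 2 * P := by positivity
        gcongr
    _ = _ := by
        rw [Finset.mul_sum]
        refine Finset.sum_congr rfl fun n _ => ?_
        ring

lemma aux_quad {k : ℕ} (a : Fin k → ℝ) (x y : Fin (k + 1) → ℝ) (L : ℝ)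
    (hx : ∑ i, x i ^ 2 = L) (hy : ∑ i, y i ^ 2 = L)
    (h : ∀ j : Fin k, x j.castSucc + a j * x (Fin.last k) = y j.castSucc + a j * y (Fin.last k))
    (hne : y ≠ x) :
    (y (Fin.last k) - x (Fin.last k)) * (1 + ∑ j, a j ^ 2) =
      2 * (∑ j, a j * x j.castSucc - x (Fin.last k)) := by
  set s := y (Fin.last k) - x (Fin.last k) with hs
  have hyj : ∀ j : Fin k, y j.castSucc = x j.castSucc - a j * s := by
    intro j
    rw [hs]; linarith [h j]
  have hyl : y (Fin.last k) = x (Fin.last k) + s := by rw [hs]; ring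
  have hs0 : s ≠ 0 := by
    intro h0
    apply hne
    funext i
    refine Fin.lastCases ?_ (fun j => ?_) i
    · rw [hyl, h0, add_zero]
    · rw [hyj, h0]; ring
  have e : ∑ j : Fin k, y j.castSucc ^ 2 = ∑ j : Fin k, x j.castSucc ^ 2
      - 2 * s * ∑ j, a j * x j.castSucc + s ^ 2 * ∑ j, a j ^ 2 := by
    rw [Finset.mul_sum, Finset.mul_sum, ← Finset.sum_sub_distrib, ← Finset.sum_add_distrib]
    refine Finset.sum_congr rfl fun j _ => ?_
    rw [hyj]; ring
  rw [Fin.sum_univ_castSucc] at hx hy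
  rw [e, hyl] at hy
  apply mul_left_cancel₀ hs0
  linear_combination hy - hx

lemma aux_card {k : ℕ} (p q : Fin k → ℤ) (hq : ∀ j, 1 ≤ q j) (L : ℝ)
    (E : Finset (Fin (k + 1) → ℤ)) (hE : ∀ n ∈ E, (∑ i, ((n i : ℝ)) ^ 2) = L)
    (n : Fin (k + 1) → ℤ) :
    (E.filter (fun n' : Fin (k + 1) → ℤ =>
      (fun j : Fin k => q j * n j.castSucc + p j * n (Fin.last k)) =
      (fun j : Fin k => q j * n' j.castSucc + p j * n' (Fin.last k)))).card ≤ 2 := by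
  by_contra hcon
  push Not at hcon
  obtain ⟨x, y, z, hx, hy, hz, hxy, hxz, hyz⟩ := Finset.two_lt_card_iff.1 hcon
  rw [Finset.mem_filter] at hx hy hz
  have cast_ne : ∀ u v : Fin (k + 1) → ℤ, u ≠ v →
      (fun i => (u i : ℝ)) ≠ (fun i => (v i : ℝ)) := by
    intro u v huv h
    apply huv
    funext i
    exact_mod_cast congrFun h i
  have key : ∀ u v : Fin (k + 1) → ℤ,
      (fun j : Fin k => q j * u j.castSucc + p j * u (Fin.last k)) =
      (fun j : Fin k => q j * v j.castSucc + p j * v (Fin.last k)) →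
      ∀ j : Fin k, (u j.castSucc : ℝ) + (p j : ℝ) / q j * u (Fin.last k) =
        v j.castSucc + (p j : ℝ) / q j * v (Fin.last k) := by
    intro u v huv j
    have h1 := congrFun huv j
    have h2 : (q j : ℝ) * u j.castSucc + p j * u (Fin.last k) =
      q j * v j.castSucc + p j * v (Fin.last k) := by exact_mod_cast h1
    have hq0 : (q j : ℝ) ≠ 0 := by
      have := hq j
      exact_mod_cast (by omega : q j ≠ 0)
    field_simp
    linarith
  have exy := key x y (hx.2.symm.trans hy.2)
  have exz := key x z (hx.2.symm.trans hz.2)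
  have q1 := aux_quad (fun j => (p j : ℝ) / q j) (fun i => (x i : ℝ)) (fun i => (y i : ℝ)) L
    (hE x hx.1) (hE y hy.1) exy (cast_ne y x hxy.symm)
  have q2 := aux_quad (fun j => (p j : ℝ) / q j) (fun i => (x i : ℝ)) (fun i => (z i : ℝ)) L
    (hE x hx.1) (hE z hz.1) exz (cast_ne z x hxz.symm)
  have hpos : (0 : ℝ) < 1 + ∑ j, ((p j : ℝ) / q j) ^ 2 := by positivity
  have hl : (y (Fin.last k) : ℝ) = z (Fin.last k) := by
    have := mul_right_cancel₀ hpos.ne' (q1.trans q2.symm)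
    linarith
  apply cast_ne y z hyz
  funext i
  refine Fin.lastCases hl (fun j => ?_) i
  have h1 := exy j
  have h2 := exz j
  rw [hl] at h1
  linarith

lemma aux_main (k : ℕ) (p q : Fin k → ℤ) (hq : ∀ j, 1 ≤ q j) (hpq : ∀ j, |p j| ≤ q j)
    (lam : ℝ) (E : Finset (Fin (k + 1) → ℤ))
    (hE : ∀ n : Fin (k + 1) → ℤ, n ∈ E ↔ (∑ i, ((n i : ℝ)) ^ 2) = lam ^ 2)
    (c : (Fin (k + 1) → ℤ) → ℂ) (x₀ : Fin (k + 1) → ℝ) :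
    Real.sqrt (1 + ∑ j, ((p j : ℝ) / (q j : ℝ)) ^ 2) *
      (∫ t in Set.univ.pi (fun _ : Fin k => Set.Icc (-1 : ℝ) 1),
        ‖∑ n ∈ E, c n *
          Complex.exp (Complex.I * (dotIR n (fun i =>
            x₀ i + (if h : i.val < k then t ⟨i.val, h⟩
              else ∑ j, ((p j : ℝ) / (q j : ℝ)) * t j)) : ℂ))‖ ^ 2)
      ≤ (Real.sqrt (1 + k) * (2 * (2 * Real.pi) ^ k)) * (∏ j, (q j : ℝ)) *
        ∑ n ∈ E, ‖c n‖ ^ 2 := by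
  have hphase : ∀ (n : Fin (k + 1) → ℤ) (t : Fin k → ℝ),
      c n * Complex.exp (Complex.I * (dotIR n (fun i =>
            x₀ i + (if h : i.val < k then t ⟨i.val, h⟩
              else ∑ j, ((p j : ℝ) / (q j : ℝ)) * t j)) : ℂ)) =
      (c n * Complex.exp (Complex.I * (dotIR n x₀ : ℂ))) *
        Complex.exp (Complex.I * ∑ j,
          (((q j * n j.castSucc + p j * n (Fin.last k) : ℤ) : ℂ) / (q j : ℂ) * (t j : ℂ))) := by
    intro n t
    rw [mul_assoc, ← Complex.exp_add, ← mul_add]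
    congr 3
    have hr : dotIR n (fun i => x₀ i + (if h : i.val < k then t ⟨i.val, h⟩
              else ∑ j, ((p j : ℝ) / (q j : ℝ)) * t j)) = dotIR n x₀ +
        ∑ j, (((q j * n j.castSucc + p j * n (Fin.last k) : ℤ) : ℝ) / (q j : ℝ) * t j) := by
      unfold dotIR
      simp only [mul_add, Finset.sum_add_distrib]
      congr 1
      rw [Fin.sum_univ_castSucc]
      simp only [Fin.val_castSucc, Fin.is_lt, dite_true, Fin.val_last, lt_irrefl, dite_false,
        Fin.eta]
      rw [Finset.mul_sum, ← Finset.sum_add_distrib]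
      refine Finset.sum_congr rfl fun j _ => ?_
      have hq0 : (q j : ℝ) ≠ 0 := by
        have := hq j
        exact_mod_cast (by omega : q j ≠ 0)
      push_cast
      field_simp
    rw [hr]
    push_cast
    rfl
  simp_rw [hphase]
  have hb := aux_bound q hq E (fun n => c n * Complex.exp (Complex.I * (dotIR n x₀ : ℂ)))
    (fun n j => q j * n j.castSucc + p j * n (Fin.last k))
    (fun n _ => aux_card p q hq (lam ^ 2) E (fun n hn => (hE n).1 hn) n)
  have hnorm : ∀ n, ‖c n * Complex.exp (Complex.I * (dotIR n x₀ : ℂ))‖ = ‖c n‖ := by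
    intro n
    rw [norm_mul, mul_comm Complex.I, Complex.norm_exp_ofReal_mul_I, mul_one]
  simp only [hnorm] at hb
  have hsq : Real.sqrt (1 + ∑ j, ((p j : ℝ) / (q j : ℝ)) ^ 2) ≤ Real.sqrt (1 + k) := by
    apply Real.sqrt_le_sqrt
    have : ∑ j, ((p j : ℝ) / (q j : ℝ)) ^ 2 ≤ ∑ _j : Fin k, (1 : ℝ) := by
      refine Finset.sum_le_sum fun j _ => ?_
      have hq1 : (1 : ℝ) ≤ q j := by exact_mod_cast hq j
      have hp1 : |(p j : ℝ)| ≤ q j := by exact_mod_cast hpq j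
      rw [sq_le_one_iff_abs_le_one, abs_div, abs_of_pos (by linarith : (0 : ℝ) < q j)]
      exact div_le_one_of_le₀ hp1 (by linarith)
    simpa using this
  refine (mul_le_mul hsq hb (integral_nonneg fun t => by positivity)
    (Real.sqrt_nonneg _)).trans (le_of_eq ?_)
  rw [Finset.prod_mul_distrib, Finset.prod_const, Finset.card_univ, Fintype.card_fin]
  ring

theorem stmt10 (d : ℕ) (hd : 2 ≤ d) :
    ∃ C : ℝ, 0 < C ∧
      ∀ (p q : Fin (d - 1) → ℤ),
        (∀ j, Int.gcd (p j) (q j) = 1) → (∀ j, 1 ≤ q j) → (∀ j, |p j| ≤ q j) →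
        ∀ (lam : ℝ), 1 ≤ lam →
          ∀ (E : Finset (Fin d → ℤ)),
            (∀ n : Fin d → ℤ, n ∈ E ↔ (∑ i, ((n i : ℝ)) ^ 2) = lam ^ 2) →
              ∀ (c : (Fin d → ℤ) → ℂ) (x₀ : Fin d → ℝ),
                Real.sqrt (1 + ∑ j, ((p j : ℝ) / (q j : ℝ)) ^ 2) *
                  (∫ t in Set.univ.pi (fun _ : Fin (d - 1) => Set.Icc (-1 : ℝ) 1),
                    ‖∑ n ∈ E, c n *
                      Complex.exp (Complex.I * (dotIR n (fun i =>
                        x₀ i + (if h : i.val < d - 1 then t ⟨i.val, h⟩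
                          else ∑ j, ((p j : ℝ) / (q j : ℝ)) * t j)) : ℂ))‖ ^ 2)
                  ≤ C * (∏ j, (q j : ℝ)) * ∑ n ∈ E, ‖c n‖ ^ 2 := by
  obtain ⟨k, rfl⟩ : ∃ k, d = k + 1 := ⟨d - 1, by omega⟩
  refine ⟨Real.sqrt (1 + k) * (2 * (2 * Real.pi) ^ k), ?_, ?_⟩
  · have := Real.pi_pos
    positivity
  · intro p q _ hq hpq lam _ E hE c x₀
    exact aux_main k p q hq hpq lam E hE c x₀
end

section
/- There is an absolute constant C > 0 such that for every μ ∈ ℝ with |μ| ≤ 1 and every finitely supported function a : ℤ → ℂ, one has Σ_{s∈ℤ} |Σ_{t∈ℤ} K_μ(t−s) a(t)|² ≤ C · Σ_{t∈ℤ} |a(t)|², where K_μ(n) = sin(μn)/n for n ≠ 0 and K_μ(0) = μ. That is, the operators T_μ : (a_t) ↦ (Σ_t K_μ(t−s) a_t)_s are bounded on ℓ²(ℤ) uniformly for |μ| ≤ 1. -/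
/-- The kernel `K_μ(n) = sin(μn)/n` for `n ≠ 0`, and `K_μ(0) = μ`. -/
noncomputable def hilbKernel (μ : ℝ) (n : ℤ) : ℝ :=
  if n = 0 then μ else Real.sin (μ * n) / n

open MeasureTheory Set in
theorem hk_integral (μ : ℝ) (n : ℤ) :
    ∫ x in (-μ)..μ, Complex.exp (n * x * Complex.I) = 2 * (hilbKernel μ n : ℂ) := by
  unfold hilbKernel
  split_ifs with h
  · subst h
    simp
    ring
  · have hc : (n * Complex.I : ℂ) ≠ 0 := by simp [h]
    have h1 : ∀ x : ℝ, Complex.exp (n * x * Complex.I) = Complex.exp ((n * Complex.I) * x) := by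
      intro x; congr 1; ring
    simp_rw [h1]
    rw [integral_exp_mul_complex hc]
    push_cast
    rw [Complex.sin]
    have hn : (n : ℂ) ≠ 0 := by exact_mod_cast h
    have e1 : (n * Complex.I * μ : ℂ) = μ * n * Complex.I := by ring
    have e2 : (n * Complex.I * -μ : ℂ) = -(μ * n) * Complex.I := by ring
    rw [e1, e2]
    field_simp
    rw [Complex.I_sq]
    ring

noncomputable def hkF (a : ℤ →₀ ℂ) (x : ℝ) : ℂ :=
  ∑ t ∈ a.support, a t * Complex.exp (t * x * Complex.I)

theorem hkF_cont (a : ℤ →₀ ℂ) : Continuous (hkF a) := by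
  unfold hkF; fun_prop

theorem hk_lt : -Real.pi < Real.pi := by linarith [Real.pi_pos]

open MeasureTheory Set in
theorem hk_coeff (μ : ℝ) (h0 : 0 ≤ μ) (h1 : μ ≤ Real.pi) (a : ℤ →₀ ℂ) (s : ℤ) :
    fourierCoeffOn hk_lt ((Ioc (-μ) μ).indicator (hkF a)) s =
      (1 / Real.pi : ℂ) * ∑ t ∈ a.support, (hilbKernel μ (t - s) : ℂ) * a t := by
  have hpi : (Real.pi : ℂ) ≠ 0 := by exact_mod_cast Real.pi_ne_zero
  rw [fourierCoeffOn_eq_integral]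
  have e : ∫ x in (-Real.pi)..Real.pi, fourier (-s) (x : AddCircle (Real.pi - -Real.pi)) •
      (Ioc (-μ) μ).indicator (hkF a) x =
      ∑ t ∈ a.support, 2 * (hilbKernel μ (t - s) : ℂ) * a t := by
    have e1 : ∀ x : ℝ, fourier (-s) (x : AddCircle (Real.pi - -Real.pi)) •
      (Ioc (-μ) μ).indicator (hkF a) x = (Ioc (-μ) μ).indicator
        (fun x : ℝ => ∑ t ∈ a.support, Complex.exp ((t - s : ℤ) * x * Complex.I) * a t) x := by
      intro x
      by_cases hx : x ∈ Ioc (-μ) μ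
      · rw [indicator_of_mem hx, indicator_of_mem hx, hkF, fourier_coe_apply, smul_eq_mul,
          Finset.mul_sum]
        refine Finset.sum_congr rfl fun t _ => ?_
        rw [mul_left_comm, ← Complex.exp_add, mul_comm]
        congr 2
        push_cast
        field_simp
        ring
      · rw [indicator_of_notMem hx, indicator_of_notMem hx, smul_zero]
    simp_rw [e1]
    rw [intervalIntegral.integral_of_le hk_lt.le, setIntegral_indicator measurableSet_Ioc,
      inter_eq_self_of_subset_right (Ioc_subset_Ioc (by linarith) h1),
      ← intervalIntegral.integral_of_le (by linarith), intervalIntegral.integral_finsetSum]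
    · refine Finset.sum_congr rfl fun t _ => ?_
      rw [intervalIntegral.integral_mul_const, hk_integral]
    · intro t _
      exact Continuous.intervalIntegrable (by fun_prop) _ _
  rw [e, Complex.real_smul, Finset.mul_sum, Finset.mul_sum]
  refine Finset.sum_congr rfl fun t _ => ?_
  push_cast
  field_simp
  ring

open MeasureTheory Set in
theorem hk_memLp (μ : ℝ) (a : ℤ →₀ ℂ) :
    MemLp ((Ioc (-μ) μ).indicator (hkF a)) 2 (volume.restrict (Ioc (-Real.pi) Real.pi)) := by
  refine MemLp.indicator measurableSet_Ioc ?_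
  obtain ⟨C, hC⟩ := isCompact_Icc.exists_bound_of_continuousOn (s := Icc (-Real.pi) Real.pi)
    (hkF_cont a).continuousOn
  refine MemLp.of_bound (hkF_cont a).aestronglyMeasurable C ?_
  exact (ae_restrict_iff' measurableSet_Ioc).2 (ae_of_all _ fun x hx => hC x (Ioc_subset_Icc_self hx))

open MeasureTheory Set in
theorem hk_pos (μ : ℝ) (h0 : 0 ≤ μ) (h1 : μ ≤ Real.pi) (a : ℤ →₀ ℂ) :
    ∑' s : ℤ, ENNReal.ofReal (‖∑ t ∈ a.support, (hilbKernel μ (t - s) : ℂ) * a t‖ ^ 2)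
      ≤ ENNReal.ofReal (Real.pi ^ 2 * ∑ t ∈ a.support, ‖a t‖ ^ 2) := by
  have hpi : (Real.pi : ℂ) ≠ 0 := by exact_mod_cast Real.pi_ne_zero
  have A := hasSum_sq_fourierCoeffOn hk_lt (hk_memLp μ a)
  have B := hasSum_sq_fourierCoeffOn hk_lt (hk_memLp Real.pi a)
  have hB : ∀ s, fourierCoeffOn hk_lt ((Ioc (-Real.pi) Real.pi).indicator (hkF a)) s = a s := by
    intro s
    rw [hk_coeff _ Real.pi_pos.le le_rfl]
    have : ∀ t, (hilbKernel Real.pi (t - s) : ℂ) * a t = if t = s then Real.pi * a s else 0 := by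
      intro t
      unfold hilbKernel
      by_cases h : t = s
      · simp [h]
      · have : t - s ≠ 0 := sub_ne_zero.2 h
        rw [if_neg this, if_neg h, mul_comm Real.pi, Real.sin_int_mul_pi]
        simp
    simp_rw [this]
    rw [Finset.sum_ite_eq']
    split_ifs with h
    · field_simp
    · simpa using (Finsupp.notMem_support_iff.1 h).symm
  simp_rw [hB] at B
  have B' : HasSum (fun s => ‖a s‖ ^ 2) (∑ t ∈ a.support, ‖a t‖ ^ 2) :=
    hasSum_sum_of_ne_finset_zero fun s hs => by simp [Finsupp.notMem_support_iff.1 hs]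
  simp_rw [hk_coeff μ h0 h1 a] at A
  have A' := A.mul_left (Real.pi ^ 2)
  have e : ∀ s : ℤ, Real.pi ^ 2 * ‖(1 / Real.pi : ℂ) * ∑ t ∈ a.support,
      (hilbKernel μ (t - s) : ℂ) * a t‖ ^ 2 =
      ‖∑ t ∈ a.support, (hilbKernel μ (t - s) : ℂ) * a t‖ ^ 2 := by
    intro s
    have := Real.pi_pos
    rw [norm_mul, mul_pow, norm_div, norm_one, Complex.norm_real, Real.norm_of_nonneg this.le]
    field_simp
  simp_rw [e] at A'
  rw [← ENNReal.ofReal_tsum_of_nonneg (fun _ => by positivity) A'.summable, A'.tsum_eq]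
  apply ENNReal.ofReal_le_ofReal
  rw [B'.unique B]
  refine mul_le_mul_of_nonneg_left ?_ (by positivity)
  have := Real.pi_pos
  refine smul_le_smul_of_nonneg_left ?_ (by rw [inv_nonneg]; linarith)
  have int : ∀ ν : ℝ, IntervalIntegrable
      (fun x => ‖(Ioc (-ν) ν).indicator (hkF a) x‖ ^ 2) volume (-Real.pi) Real.pi := fun ν => by
    rw [intervalIntegrable_iff_integrableOn_Ioc_of_le hk_lt.le]
    exact (hk_memLp ν a).integrable_norm_pow two_ne_zero
  refine intervalIntegral.integral_mono_on hk_lt.le (int _) (int _) fun x _ => ?_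
  gcongr
  exact norm_indicator_le_of_subset (Ioc_subset_Ioc (by linarith) h1) _ _

theorem stmt11 :
    ∃ C : ℝ, 0 < C ∧
      ∀ (μ : ℝ), |μ| ≤ 1 →
        ∀ (a : ℤ →₀ ℂ),
          (∑' s : ℤ, ENNReal.ofReal
              (‖∑ t ∈ a.support, (hilbKernel μ (t - s) : ℂ) * a t‖ ^ 2))
            ≤ ENNReal.ofReal (C * ∑ t ∈ a.support, ‖a t‖ ^ 2) := by
  refine ⟨Real.pi ^ 2, by positivity, fun μ hμ a => ?_⟩
  have hp := Real.pi_gt_three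
  obtain ⟨l, u⟩ := abs_le.1 hμ
  rcases le_total 0 μ with h | h
  · exact hk_pos μ h (by linarith) a
  · have := hk_pos (-μ) (by linarith) (by linarith) a
    have e : ∀ n, hilbKernel (-μ) n = - hilbKernel μ n := by
      intro n
      unfold hilbKernel
      split_ifs
      · rfl
      · rw [neg_mul, Real.sin_neg, neg_div]
    simpa only [e, Complex.ofReal_neg, neg_mul, Finset.sum_neg_distrib, norm_neg] using this
end

section
/- Let d ≥ 2. There exist constants c > 0 and C > 0, depending only on d, such that the following holds for every real R ≥ 1. Let A₁, A₂, A₃ ∈ ℤ^d be three non-collinear lattice points all of whose coordinates have absolute value at most R. Then the circumcenter X₀ of A₁, A₂, A₃ — the unique point of the affine 2-plane through A₁, A₂, A₃ satisfying |X₀ − A₁| = |X₀ − A₂| = |X₀ − A₃| — has all coordinates rational, and each coordinate x_{0j} of X₀ satisfies H(x_{0j}) ≤ C·R^c. -/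
/-- The height of a rational number `p/q` in lowest terms: `max(|p|, q)`. -/
def ratHeight (x : ℚ) : ℕ := max x.num.natAbs x.den

lemma ratHeight_le_aux (N M : ℤ) (hM : M ≠ 0) (B : ℝ) (hN : |(N : ℝ)| ≤ B) (hMB : |(M : ℝ)| ≤ B) :
    (ratHeight ((N : ℚ) / (M : ℚ)) : ℝ) ≤ B := by
  unfold ratHeight
  rw [Nat.cast_max]
  apply max_le
  · refine le_trans ?_ hN
    rw [Nat.cast_natAbs]
    by_cases h0 : N = 0
    · simp [h0]
    · have h1 : ((N : ℚ) / M).num ∣ N := by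
        have := Rat.num_dvd N hM
        rwa [Rat.divInt_eq_div] at this
      have h2 := Int.natAbs_le_of_dvd_ne_zero h1 h0
      have h3 : |((N : ℚ) / M).num| ≤ |N| := by
        rw [Int.abs_eq_natAbs, Int.abs_eq_natAbs]; exact_mod_cast h2
      exact_mod_cast h3
  · refine le_trans ?_ hMB
    have h1 : (((N : ℚ) / M).den : ℤ) ∣ M := by
      have := Rat.den_dvd N M
      rwa [Rat.divInt_eq_div] at this
    have h2 := Int.natAbs_le_of_dvd_ne_zero h1 hM
    have h3 : (((N : ℚ) / M).den : ℤ) ≤ |M| := by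
      rw [Int.abs_eq_natAbs]; exact_mod_cast h2
    exact_mod_cast h3

lemma sum_bd_aux (d : ℕ) (u v : Fin d → ℤ) (R : ℝ)
    (hu : ∀ i, |(u i : ℝ)| ≤ 2 * R) (hv : ∀ i, |(v i : ℝ)| ≤ 2 * R) :
    |((∑ i, u i * v i : ℤ) : ℝ)| ≤ 4 * d * R ^ 2 := by
  push_cast
  calc |∑ i, (u i : ℝ) * v i| ≤ ∑ i, |(u i : ℝ) * v i| := Finset.abs_sum_le_sum_abs _ _
    _ ≤ ∑ _i : Fin d, (2 * R) * (2 * R) := by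
        apply Finset.sum_le_sum
        intro i _
        rw [abs_mul]
        exact mul_le_mul (hu i) (hv i) (abs_nonneg _) ((abs_nonneg _).trans (hu i))
    _ = 4 * d * R ^ 2 := by simp; ring

lemma gram_ne_aux (d : ℕ) (u v : Fin d → ℤ)
    (h : LinearIndependent ℝ ![fun i => ((u i : ℤ) : ℝ), fun i => ((v i : ℤ) : ℝ)]) :
    (∑ i, u i * u i) * (∑ i, v i * v i) - (∑ i, u i * v i) ^ 2 ≠ 0 := by
  intro hD
  rw [LinearIndependent.pair_iff] at h
  set a := ∑ i, u i * u i with ha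
  set b := ∑ i, u i * v i with hb
  set c := ∑ i, v i * v i with hc
  have h1 : ∑ i, (c * u i - b * v i) ^ 2 = 0 := by
    have key : ∀ p q : ℤ, ∑ i, (p * u i - q * v i) ^ 2 = p ^ 2 * a - 2 * p * q * b + q ^ 2 * c := by
      intro p q
      rw [ha, hb, hc, Finset.mul_sum, Finset.mul_sum, Finset.mul_sum, ← Finset.sum_sub_distrib,
        ← Finset.sum_add_distrib]
      exact Finset.sum_congr rfl fun i _ => by ring
    rw [key]; linear_combination c * hD
  have h2 : ∀ i, c * u i - b * v i = 0 := fun i => by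
    have := (Finset.sum_eq_zero_iff_of_nonneg (fun i _ => sq_nonneg (c * u i - b * v i))).1 h1 i
      (Finset.mem_univ i)
    exact pow_eq_zero_iff (two_ne_zero) |>.1 this
  have h3 := (h (c : ℝ) (-(b : ℝ)) (by
    ext i
    have := h2 i
    have h' : (c : ℝ) * u i - b * v i = 0 := by exact_mod_cast this
    simp only [Pi.add_apply, Pi.smul_apply, smul_eq_mul, Pi.zero_apply]
    linarith)).1
  have h4 : c = 0 := by exact_mod_cast h3
  have h5 : ∀ i, v i = 0 := fun i => by
    have := (Finset.sum_eq_zero_iff_of_nonneg (fun i _ => mul_self_nonneg (v i))).1 h4 i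
      (Finset.mem_univ i)
    exact mul_self_eq_zero.1 this
  have h6 := (h 0 1 (by ext i; simp [h5 i])).2
  exact one_ne_zero h6

lemma dist_aux (d : ℕ) (s t : ℚ) (A X u v e : Fin d → ℚ)
    (hX : ∀ i, X i = A i + s * u i + t * v i)
    (h : 2 * (s * (∑ i, u i * e i) + t * (∑ i, v i * e i)) = ∑ i, e i * e i) :
    ∑ i, (X i - A i) ^ 2 = ∑ i, (X i - (A i + e i)) ^ 2 := by
  have : ∑ i, (X i - (A i + e i)) ^ 2 = ∑ i, (X i - A i) ^ 2
      - 2 * (s * (∑ i, u i * e i) + t * (∑ i, v i * e i)) + ∑ i, e i * e i := by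
    simp only [Finset.mul_sum, ← Finset.sum_sub_distrib, ← Finset.sum_add_distrib]
    exact Finset.sum_congr rfl fun i _ => by rw [hX i]; ring
  rw [this]; linarith

theorem stmt12 (d : ℕ) (hd : 2 ≤ d) :
    ∃ c C : ℝ, 0 < c ∧ 0 < C ∧
      ∀ (R : ℝ), 1 ≤ R →
        ∀ (A₁ A₂ A₃ : Fin d → ℤ),
          LinearIndependent ℝ
            ![fun i => ((A₂ i - A₁ i : ℤ) : ℝ), fun i => ((A₃ i - A₁ i : ℤ) : ℝ)] →
          (∀ i, |(A₁ i : ℝ)| ≤ R) → (∀ i, |(A₂ i : ℝ)| ≤ R) → (∀ i, |(A₃ i : ℝ)| ≤ R) →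
            ∃ X₀ : Fin d → ℚ,
              (∃ s t : ℚ, ∀ i, X₀ i =
                (A₁ i : ℚ) + s * ((A₂ i : ℚ) - (A₁ i : ℚ)) + t * ((A₃ i : ℚ) - (A₁ i : ℚ))) ∧
              (∑ i, (X₀ i - (A₁ i : ℚ)) ^ 2) = (∑ i, (X₀ i - (A₂ i : ℚ)) ^ 2) ∧
              (∑ i, (X₀ i - (A₁ i : ℚ)) ^ 2) = (∑ i, (X₀ i - (A₃ i : ℚ)) ^ 2) ∧
              ∀ i, (ratHeight (X₀ i) : ℝ) ≤ C * R ^ c := by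
  have hd0 : (0 : ℝ) < d := by exact_mod_cast (by omega : 0 < d)
  refine ⟨5, 192 * (d : ℝ) ^ 2, by norm_num, by positivity, ?_⟩
  intro R hR A₁ A₂ A₃ hli h₁ h₂ h₃
  have hpow : R ^ (5 : ℝ) = R ^ 5 := by
    rw [← Real.rpow_natCast]; norm_num
  rw [hpow]
  obtain ⟨u, hu⟩ : ∃ u : Fin d → ℤ, ∀ i, u i = A₂ i - A₁ i := ⟨_, fun _ => rfl⟩
  obtain ⟨v, hv⟩ : ∃ v : Fin d → ℤ, ∀ i, v i = A₃ i - A₁ i := ⟨_, fun _ => rfl⟩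
  simp only [← hu, ← hv] at hli
  have hD := gram_ne_aux d u v hli
  have hub : ∀ i, |(u i : ℝ)| ≤ 2 * R := fun i => by
    rw [hu i]; push_cast
    linarith [abs_sub (A₂ i : ℝ) (A₁ i), h₁ i, h₂ i]
  have hvb : ∀ i, |(v i : ℝ)| ≤ 2 * R := fun i => by
    rw [hv i]; push_cast
    linarith [abs_sub (A₃ i : ℝ) (A₁ i), h₁ i, h₃ i]
  have hab := sum_bd_aux d u u R hub hub
  have hbb := sum_bd_aux d u v R hub hvb
  have hcb := sum_bd_aux d v v R hvb hvb
  obtain ⟨a, ha⟩ : ∃ a, a = ∑ i, u i * u i := ⟨_, rfl⟩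
  obtain ⟨b, hb⟩ : ∃ b, b = ∑ i, u i * v i := ⟨_, rfl⟩
  obtain ⟨c, hc⟩ : ∃ c, c = ∑ i, v i * v i := ⟨_, rfl⟩
  rw [← ha, ← hb, ← hc] at hD
  rw [← ha] at hab
  rw [← hb] at hbb
  rw [← hc] at hcb
  have haq : ∑ i, (u i : ℚ) * u i = a := by rw [ha]; push_cast; rfl
  have hbq : ∑ i, (u i : ℚ) * v i = b := by rw [hb]; push_cast; rfl
  have hbq' : ∑ i, (v i : ℚ) * u i = b := by
    rw [← hbq]; exact Finset.sum_congr rfl fun i _ => mul_comm _ _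
  have hcq : ∑ i, (v i : ℚ) * v i = c := by rw [hc]; push_cast; rfl
  have hDq : (a : ℚ) * c - b ^ 2 ≠ 0 := by exact_mod_cast hD
  have hA2 : ∀ i, (A₂ i : ℚ) = A₁ i + u i := fun i => by rw [hu i]; push_cast; ring
  have hA3 : ∀ i, (A₃ i : ℚ) = A₁ i + v i := fun i => by rw [hv i]; push_cast; ring
  have h2D : (2 : ℚ) * (a * c - b ^ 2) ≠ 0 := mul_ne_zero two_ne_zero hDq
  obtain ⟨D, hDd⟩ : ∃ D : ℚ, D = a * c - b ^ 2 := ⟨_, rfl⟩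
  rw [← hDd] at h2D hDq
  obtain ⟨s, hs⟩ : ∃ s : ℚ, s = (c * (a - b)) / (2 * D) := ⟨_, rfl⟩
  obtain ⟨t, ht⟩ : ∃ t : ℚ, t = (a * (c - b)) / (2 * D) := ⟨_, rfl⟩
  refine ⟨fun i => (A₁ i : ℚ) + s * u i + t * v i, ⟨s, t, fun i => ?_⟩, ?_, ?_, ?_⟩
  · rw [hA2, hA3]; ring
  · simp only [hA2]
    refine dist_aux d s t (fun i => (A₁ i : ℚ)) _ (fun i => (u i : ℚ)) (fun i => (v i : ℚ))
      (fun i => (u i : ℚ)) (fun i => rfl) ?_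
    rw [haq, hbq', hs, ht]
    field_simp
    rw [hDd]
    ring
  · simp only [hA3]
    refine dist_aux d s t (fun i => (A₁ i : ℚ)) _ (fun i => (u i : ℚ)) (fun i => (v i : ℚ))
      (fun i => (v i : ℚ)) (fun i => rfl) ?_
    rw [hbq, hcq, hs, ht]
    field_simp
    rw [hDd]
    ring
  · intro i
    have hx : (A₁ i : ℚ) + s * u i + t * v i =
        ((2 * (a * c - b ^ 2) * A₁ i + c * (a - b) * u i + a * (c - b) * v i : ℤ) : ℚ)
          / ((2 * (a * c - b ^ 2) : ℤ) : ℚ) := by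
      push_cast
      rw [← hDd, hs, ht]
      field_simp
    simp only [hx]
    have hR0 : 0 ≤ R := by linarith
    have hK : (0 : ℝ) ≤ 4 * d * R ^ 2 := by positivity
    obtain ⟨K, hKd⟩ : ∃ K : ℝ, K = 4 * d * R ^ 2 := ⟨_, rfl⟩
    rw [← hKd] at hab hbb hcb hK
    have hm : ∀ x y X Y : ℝ, |x| ≤ X → |y| ≤ Y → |x * y| ≤ X * Y := fun x y X Y h1 h2 => by
      rw [abs_mul]; exact mul_le_mul h1 h2 (abs_nonneg _) ((abs_nonneg _).trans h1)
    have hsub : ∀ x y X Y : ℝ, |x| ≤ X → |y| ≤ Y → |x - y| ≤ X + Y := fun x y X Y h1 h2 =>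
      (abs_sub x y).trans (add_le_add h1 h2)
    have hadd : ∀ x y X Y : ℝ, |x| ≤ X → |y| ≤ Y → |x + y| ≤ X + Y := fun x y X Y h1 h2 =>
      (abs_add_le x y).trans (add_le_add h1 h2)
    have h22 : |(2 : ℝ)| ≤ 2 := by norm_num
    have hMb : |(2 : ℝ) * (a * c - b * b)| ≤ 2 * (K * K + K * K) :=
      hm _ _ _ _ h22 (hsub _ _ _ _ (hm _ _ _ _ hab hcb) (hm _ _ _ _ hbb hbb))
    have hNb := hadd _ _ _ _ (hadd _ _ _ _ (hm _ _ _ _ hMb (h₁ i))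
      (hm _ _ _ _ (hm _ _ _ _ hcb (hsub _ _ _ _ hab hbb)) (hub i)))
      (hm _ _ _ _ (hm _ _ _ _ hab (hsub _ _ _ _ hcb hbb)) (hvb i))
    apply ratHeight_le_aux
    · exact mul_ne_zero two_ne_zero hD
    · push_cast
      rw [pow_two (b : ℝ)]
      refine hNb.trans (le_of_eq ?_)
      rw [hKd]; ring
    · push_cast
      rw [pow_two (b : ℝ)]
      refine hMb.trans ?_
      have h1 : R ^ 4 ≤ R ^ 5 := pow_le_pow_right₀ hR (by norm_num)
      have h2 : (d : ℝ) ^ 2 * R ^ 4 ≤ d ^ 2 * R ^ 5 := by gcongr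
      have h3 : (0 : ℝ) ≤ d ^ 2 * R ^ 5 := by positivity
      rw [hKd]
      nlinarith
end

section
/- Let d ≥ 2. There exist constants c > 0 and C > 0, depending only on d, such that the following holds for every real R ≥ 1. Let A₁, A₂, A₃ ∈ ℤ^d be three non-collinear lattice points all of whose coordinates have absolute value at most R. Then there exist indices i₁ ≠ i₂ in {1,…,d} and vectors V₀, V₁, V₂ ∈ ℚ^d, each of whose coordinates has height at most C·R^c, such that the affine 2-plane through A₁, A₂, A₃ equals {V₀ + s V₁ + t V₂ : s, t ∈ ℝ}, and moreover every point X = (x₁,…,x_d) of this plane satisfies X = V₀ + x_{i₁} V₁ + x_{i₂} V₂ (i.e., the plane is parametrized by its own i₁-th and i₂-th coordinates). -/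
lemma ratHeight_div_le (n D : ℤ) (hD : D ≠ 0) (B : ℝ) (hn : |(n : ℝ)| ≤ B) (hB : |(D : ℝ)| ≤ B) :
    (ratHeight ((n : ℚ) / (D : ℚ)) : ℝ) ≤ B := by
  have h1 : (((n : ℚ) / (D : ℚ)).den : ℤ) ∣ D := by
    rw [← Rat.divInt_eq_div]
    exact Rat.den_dvd n D
  have h2 : ((n : ℚ) / (D : ℚ)).num ∣ n := by
    rw [← Rat.divInt_eq_div]
    exact Rat.num_dvd n hD
  have hDn : D.natAbs ≠ 0 := Int.natAbs_ne_zero.mpr hD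
  have hd1 : ((n : ℚ) / (D : ℚ)).den ≤ D.natAbs := by
    have := Int.natAbs_dvd_natAbs.mpr h1
    exact Nat.le_of_dvd (Nat.pos_of_ne_zero hDn) (by simpa using this)
  have hd2 : ((n : ℚ) / (D : ℚ)).num.natAbs ≤ n.natAbs := by
    rcases eq_or_ne n 0 with rfl | hn0
    · simp
    · exact Nat.le_of_dvd (Int.natAbs_pos.mpr hn0) (Int.natAbs_dvd_natAbs.mpr h2)
  have e : ∀ m : ℤ, ((m.natAbs : ℕ) : ℝ) = |(m : ℝ)| := fun m => by
    rw [Nat.cast_natAbs, Int.cast_abs]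
  unfold ratHeight
  rw [Nat.cast_max]
  refine max_le ?_ ?_
  · exact (Nat.cast_le.mpr hd2).trans ((e n).le.trans hn)
  · exact (Nat.cast_le.mpr hd1).trans ((e D).le.trans hB)

theorem stmt13 (d : ℕ) (hd : 2 ≤ d) :
    ∃ c C : ℝ, 0 < c ∧ 0 < C ∧
      ∀ (R : ℝ), 1 ≤ R →
        ∀ (A₁ A₂ A₃ : Fin d → ℤ),
          LinearIndependent ℝ
            ![fun i => ((A₂ i - A₁ i : ℤ) : ℝ), fun i => ((A₃ i - A₁ i : ℤ) : ℝ)] →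
          (∀ i, |(A₁ i : ℝ)| ≤ R) → (∀ i, |(A₂ i : ℝ)| ≤ R) → (∀ i, |(A₃ i : ℝ)| ≤ R) →
            ∃ (i₁ i₂ : Fin d), i₁ ≠ i₂ ∧
              ∃ V₀ V₁ V₂ : Fin d → ℚ,
                (∀ i, (ratHeight (V₀ i) : ℝ) ≤ C * R ^ c) ∧
                (∀ i, (ratHeight (V₁ i) : ℝ) ≤ C * R ^ c) ∧
                (∀ i, (ratHeight (V₂ i) : ℝ) ≤ C * R ^ c) ∧
                ({X : Fin d → ℝ | ∃ s t : ℝ,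
                    X = fun i => (V₀ i : ℝ) + s * (V₁ i : ℝ) + t * (V₂ i : ℝ)} =
                 {X : Fin d → ℝ | ∃ s t : ℝ,
                    X = fun i => (A₁ i : ℝ) + s * ((A₂ i : ℝ) - (A₁ i : ℝ)) +
                      t * ((A₃ i : ℝ) - (A₁ i : ℝ))}) ∧
                ∀ X : Fin d → ℝ,
                  (∃ s t : ℝ, X = fun i => (A₁ i : ℝ) + s * ((A₂ i : ℝ) - (A₁ i : ℝ)) +
                      t * ((A₃ i : ℝ) - (A₁ i : ℝ))) →
                  ∀ i, X i = (V₀ i : ℝ) + X i₁ * (V₁ i : ℝ) + X i₂ * (V₂ i : ℝ) := by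
  refine ⟨3, 24, by norm_num, by norm_num, ?_⟩
  intro R hR A₁ A₂ A₃ hli h1 h2 h3
  have hu : ∀ i, |((A₂ i - A₁ i : ℤ) : ℝ)| ≤ 2 * R := fun i => by
    push_cast
    have := abs_sub (A₂ i : ℝ) (A₁ i)
    linarith [h1 i, h2 i]
  have hv : ∀ i, |((A₃ i - A₁ i : ℤ) : ℝ)| ≤ 2 * R := fun i => by
    push_cast
    have := abs_sub (A₃ i : ℝ) (A₁ i)
    linarith [h1 i, h3 i]
  set u : Fin d → ℤ := fun i => A₂ i - A₁ i with hud
  set v : Fin d → ℤ := fun i => A₃ i - A₁ i with hvd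
  have hex : ∃ i j, u i * v j - u j * v i ≠ 0 := by
    by_contra! hcon
    rw [LinearIndependent.pair_iff] at hli
    have key : ∀ j, u j = 0 := by
      intro j
      have := hli (v j : ℝ) (-(u j : ℝ)) (by
        funext i
        have := hcon i j
        have h' : ((u i * v j - u j * v i : ℤ) : ℝ) = 0 := by rw [this]; simp
        push_cast at h'
        simp only [Pi.add_apply, Pi.smul_apply, smul_eq_mul, Pi.zero_apply]
        simp only [hud, hvd] at h' ⊢
        push_cast at h' ⊢
        linarith)
      have h0 := this.2
      rw [neg_eq_zero] at h0
      exact_mod_cast h0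
    have := hli 1 0 (by
      funext i
      have := key i
      simp only [hud] at this
      simp
      exact_mod_cast this)
    exact one_ne_zero this.1
  obtain ⟨p, q, hD⟩ := hex
  have hm : ∀ x y z w : ℤ, |(x : ℝ)| ≤ 2 * R → |(y : ℝ)| ≤ 2 * R → |(z : ℝ)| ≤ 2 * R →
      |(w : ℝ)| ≤ 2 * R → |((x * y - z * w : ℤ) : ℝ)| ≤ 8 * R ^ 2 := by
    intro x y z w hx hy hz hw
    push_cast
    have e1 := abs_sub ((x : ℝ) * y) (z * w)
    rw [abs_mul, abs_mul] at e1
    have e2 := mul_le_mul hx hy (abs_nonneg _) (by linarith)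
    have e3 := mul_le_mul hz hw (abs_nonneg _) (by linarith)
    nlinarith
  have hR2 : 8 * R ^ 2 ≤ 24 * R ^ (3 : ℕ) := by nlinarith [sq_nonneg R, mul_le_mul_of_nonneg_left hR (sq_nonneg R)]
  have hpow : (24 : ℝ) * R ^ (3 : ℝ) = 24 * R ^ (3 : ℕ) := by norm_cast
  have hDb := hm _ _ _ _ (hu p) (hv q) (hu q) (hv p)
  have hN1 : ∀ i, |((u i * v q - u q * v i : ℤ) : ℝ)| ≤ 8 * R ^ 2 := fun i =>
    hm _ _ _ _ (hu i) (hv q) (hu q) (hv i)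
  have hN2 : ∀ i, |((u p * v i - u i * v p : ℤ) : ℝ)| ≤ 8 * R ^ 2 := fun i =>
    hm _ _ _ _ (hu p) (hv i) (hu i) (hv p)
  set D : ℤ := u p * v q - u q * v p with hDd
  have hDR : (D : ℝ) ≠ 0 := by exact_mod_cast hD
  have hDe : (D : ℝ) = (u p : ℝ) * v q - u q * v p := by rw [hDd]; push_cast; ring
  have huR : ∀ i, (A₂ i : ℝ) - A₁ i = u i := fun i => by simp [hud]
  have hvR : ∀ i, (A₃ i : ℝ) - A₁ i = v i := fun i => by simp [hvd]
  rw [hpow]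
  simp only [huR, hvR]
  clear_value D u v
  have hpar : ∀ s t : ℝ, ∀ i, (A₁ i : ℝ) + s * u i + t * v i =
      (((A₁ i * D - A₁ p * (u i * v q - u q * v i) - A₁ q * (u p * v i - u i * v p) : ℤ) : ℝ) / D)
        + ((A₁ p : ℝ) + s * u p + t * v p) * (((u i * v q - u q * v i : ℤ) : ℝ) / D)
        + ((A₁ q : ℝ) + s * u q + t * v q) * (((u p * v i - u i * v p : ℤ) : ℝ) / D) := by
    intro s t i
    field_simp
    push_cast
    rw [hDe]
    ring
  refine ⟨p, q, ?_, 
    fun i => ((A₁ i * D - A₁ p * (u i * v q - u q * v i) - A₁ q * (u p * v i - u i * v p) : ℤ) : ℚ) / (D : ℚ),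
    fun i => ((u i * v q - u q * v i : ℤ) : ℚ) / (D : ℚ),
    fun i => ((u p * v i - u i * v p : ℤ) : ℚ) / (D : ℚ), ?_, ?_, ?_, ?_, ?_⟩
  · rintro rfl
    exact hD (by rw [hDd]; ring)
  · intro i
    refine ratHeight_div_le _ _ hD _ ?_ (hDb.trans hR2)
    have a1 := mul_le_mul (h1 i) hDb (abs_nonneg _) (by linarith)
    have a2 := mul_le_mul (h1 p) (hN1 i) (abs_nonneg _) (by linarith)
    have a3 := mul_le_mul (h1 q) (hN2 i) (abs_nonneg _) (by linarith)
    rw [← abs_mul] at a1 a2 a3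
    rw [abs_le] at a1 a2 a3
    rw [Int.cast_sub, Int.cast_sub, Int.cast_mul, Int.cast_mul (A₁ p), Int.cast_mul (A₁ q), abs_le]
    constructor <;> nlinarith
  · intro i
    exact ratHeight_div_le _ _ hD _ ((hN1 i).trans hR2) (hDb.trans hR2)
  · intro i
    exact ratHeight_div_le _ _ hD _ ((hN2 i).trans hR2) (hDb.trans hR2)
  · ext X
    simp only [Set.mem_setOf_eq]
    constructor
    · rintro ⟨x, y, rfl⟩
      refine ⟨((x - A₁ p) * v q - (y - A₁ q) * v p) / D, (u p * (y - A₁ q) - u q * (x - A₁ p)) / D, ?_⟩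
      funext i
      push_cast
      field_simp
      rw [hDe]
      ring
    · rintro ⟨s, t, rfl⟩
      refine ⟨(A₁ p : ℝ) + s * u p + t * v p, (A₁ q : ℝ) + s * u q + t * v q, ?_⟩
      funext i
      rw [hpar s t i]
      push_cast
      ring
  · rintro X ⟨s, t, rfl⟩ i
    have := hpar s t i
    push_cast at this ⊢
    exact this
end
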